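/- If μ_{M,D} is a spectral measure, then ρ₁⁻¹ is an integer divisible by p. -/

import Mathlib

open MeasureTheory Complex Matrix
open scoped ENNReal

noncomputable section

/-- The exponential function `e_λ(x) = e^{-2πi⟨λ,x⟩}` on `ℝ²`. -/
def expChar (lam x : Fin 2 → ℝ) : ℂ :=
  Complex.exp ((-2 * Real.pi * Complex.I) * ((lam 0 * x 0 + lam 1 * x 1 : ℝ) : ℂ))

/-- The Fourier transform `μ̂(ξ) = ∫ e^{-2πi⟨ξ,x⟩} dμ(x)` of a measure on `ℝ²`. -/
def ftMeasure (μ : Measure (Fin 2 → ℝ)) (ξ : Fin 2 → ℝ) : ℂ :=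
  ∫ x, expChar ξ x ∂μ

/-- The mask `m_D(ξ) = (1/p) Σ_{d∈D} e^{-2πi⟨ξ,d⟩}` of a digit system `D : Fin p → ℝ²`. -/
def mask {p : ℕ} (D : Fin p → (Fin 2 → ℝ)) (ξ : Fin 2 → ℝ) : ℂ :=
  (p : ℂ)⁻¹ * ∑ i : Fin p, expChar ξ (D i)

/-- Integer digits, coerced to real vectors. -/
def digitR {p : ℕ} (D : Fin p → (Fin 2 → ℤ)) : Fin p → (Fin 2 → ℝ) :=
  fun i j => (D i j : ℝ)

/-- `μ` is the self-affine measure of the IFS `φ_d(x) = M⁻¹(x+d)`, `d ∈ D`: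
a compactly supported Borel probability measure with `μ = (1/#D) Σ_d μ ∘ φ_d⁻¹`. -/
def IsSelfAffine {p : ℕ} (μ : Measure (Fin 2 → ℝ)) (M : Matrix (Fin 2) (Fin 2) ℝ)
    (D : Fin p → (Fin 2 → ℝ)) : Prop :=
  IsProbabilityMeasure μ ∧ (∃ K : Set (Fin 2 → ℝ), IsCompact K ∧ μ Kᶜ = 0) ∧
  μ = (p : ℝ≥0∞)⁻¹ • ∑ i : Fin p, μ.map (fun x => M⁻¹.mulVec (x + D i))

/-- `Λ` is an orthogonal set of exponentials for `μ`. -/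
def IsOrthoSet (μ : Measure (Fin 2 → ℝ)) (Λ : Set (Fin 2 → ℝ)) : Prop :=
  ∀ l ∈ Λ, ∀ l' ∈ Λ, l ≠ l' → ftMeasure μ (l - l') = 0

/-- `μ` is a spectral measure: some countable set of exponentials forms an
orthonormal (Hilbert) basis of `L²(μ)`. -/
def IsSpectral (μ : Measure (Fin 2 → ℝ)) : Prop :=
  ∃ Λ : Set (Fin 2 → ℝ), Λ.Countable ∧
    ∃ b : HilbertBasis Λ ℂ (Lp ℂ 2 μ),
      ∀ lam : Λ, ⇑(b lam) =ᵐ[μ] expChar (lam : Fin 2 → ℝ)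

/-- The standing assumption on the digit set: `a = (a₁,a₂)` has entries in `[1,p-1]`
and `Z(m_D) = ⋃_{j=1}^{p-1} (j·a/p + ℤ²)`. -/
def ZeroSetCond (p : ℕ) (D : Fin p → (Fin 2 → ℤ)) (a : Fin 2 → ℤ) : Prop :=
  (∀ i, 1 ≤ a i ∧ a i ≤ (p : ℤ) - 1) ∧
  ∀ ξ : Fin 2 → ℝ, mask (digitR D) ξ = 0 ↔
    ∃ j : ℕ, 1 ≤ j ∧ j ≤ p - 1 ∧ ∃ k : Fin 2 → ℤ,
      ∀ i, ξ i = (j : ℝ) * (a i : ℝ) / p + (k i : ℝ)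

/-- The upper-triangular expanding matrix `M = [[ρ₁⁻¹, c],[0, ρ₂⁻¹]]`. -/
def Mupper (ρ₁ ρ₂ c : ℝ) : Matrix (Fin 2) (Fin 2) ℝ := !![ρ₁⁻¹, c; 0, ρ₂⁻¹]

/-- The set `E_a = {h/l : gcd(h,l)=1, l·a₂ − h·a₁ ∈ ℤ∖pℤ} ∪ {0}`. -/
def Ea (p : ℕ) (a : Fin 2 → ℤ) : Set ℝ :=
  {x | ∃ h l : ℤ, Int.gcd h l = 1 ∧ ¬ ((p : ℤ) ∣ (l * a 1 - h * a 0)) ∧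
    x = (h : ℝ) / (l : ℝ)} ∪ {0}




theorem aux_val (p : ℕ) (hp : p.Prime) : ∃ V : ValuationSubring ℝ,
    ∀ z : ℤ, (¬ (p : ℤ) ∣ z → V.valuation (z : ℝ) = 1) ∧ ((p : ℤ) ∣ z → V.valuation (z : ℝ) < 1) := by
  let A : Subring ℝ := (Int.castRingHom ℝ).range
  let P : A := ⟨(p : ℝ), ⟨(p : ℤ), by simp⟩⟩
  have hI : Ideal.span {P} ≠ ⊤ := by
    rw [Ne, Ideal.span_singleton_eq_top]
    intro h
    obtain ⟨⟨b, ⟨n, hn⟩⟩, hb⟩ := isUnit_iff_exists_inv.mp h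
    have h1 : (p : ℝ) * b = 1 := congrArg Subtype.val hb
    have h2 : (p : ℝ) * (n : ℝ) = 1 := by rw [← h1, ← hn]; simp
    have h3 : (p : ℤ) * n = 1 := by exact_mod_cast h2
    have := Int.isUnit_iff.mp (IsUnit.of_mul_eq_one _ h3)
    have := hp.two_le
    omega
  obtain ⟨V, -, hV2⟩ := Ideal.image_subset_nonunits_valuationSubring _ hI
  have hpv : V.valuation (p : ℝ) < 1 := by
    have : (p : ℝ) ∈ V.nonunits := hV2 ⟨P, Ideal.subset_span rfl, rfl⟩
    rwa [ValuationSubring.mem_nonunits_iff] at this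
  have hint : ∀ n : ℤ, V.valuation (n : ℝ) ≤ 1 := fun n => by
    rw [ValuationSubring.valuation_le_one_iff]; exact intCast_mem V n
  have hdvd : ∀ z : ℤ, (p : ℤ) ∣ z → V.valuation (z : ℝ) < 1 := by
    rintro z ⟨w, rfl⟩
    push_cast
    rw [map_mul]
    calc _ ≤ V.valuation (p : ℝ) * 1 := by gcongr; exact hint w
      _ < 1 := by simpa using hpv
  refine ⟨V, fun z => ⟨fun hz => ?_, hdvd z⟩⟩
  refine le_antisymm (hint z) ?_
  by_contra hlt
  push Not at hlt
  have hc : IsCoprime (p : ℤ) z := (Nat.prime_iff_prime_int.mp hp).coprime_iff_not_dvd.mpr hz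
  obtain ⟨u, w, huw⟩ := hc
  have h1 : (u : ℝ) * p + w * z = 1 := by exact_mod_cast huw
  have h2 : V.valuation ((u : ℝ) * p + w * z) < 1 := by
    refine lt_of_le_of_lt (V.valuation.map_add _ _) (max_lt ?_ ?_)
    · rw [map_mul]
      calc _ ≤ 1 * V.valuation (p : ℝ) := by gcongr; exact hint u
        _ < 1 := by simpa using hpv
    · rw [map_mul]
      calc _ ≤ 1 * V.valuation (z : ℝ) := by gcongr; exact hint w
        _ < 1 := by simpa using hlt
  rw [h1, map_one] at h2
  exact lt_irrefl _ h2

theorem aux_tri {Γ : Type*} [LinearOrderedCommGroupWithZero Γ] (v : Valuation ℝ Γ) (p : ℕ)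
    (hv : ∀ z : ℤ, ¬ (p : ℤ) ∣ z → v (z : ℝ) = 1) (β : ℝ) (hβ : 1 < β) (hvβ : v β ≠ 1)
    (X : Set ℝ)
    (hX : ∀ x ∈ X, ∀ y ∈ X, x ≠ y → ∃ k : ℕ, 1 ≤ k ∧ ∃ z : ℤ, ¬ (p : ℤ) ∣ z ∧ x - y = z * β ^ k)
    (x x' y y' : ℝ) (hx : x ∈ X) (hx' : x' ∈ X) (hy : y ∈ X) (hy' : y' ∈ X)
    (k l : ℕ) (z z' : ℤ) (hz : ¬ (p : ℤ) ∣ z) (hz' : ¬ (p : ℤ) ∣ z')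
    (h1 : x - x' = z * β ^ k) (h2 : y - y' = z' * β ^ l) (hkl : v β ^ l < v β ^ k) :
    ∃ m : ℕ, 1 ≤ m ∧ v β ^ k ≤ v β ^ m ∧ ∃ w : ℤ, y - y' = w * β ^ m := by
  have hβ0 : v β ≠ 0 := by rw [Ne, map_eq_zero]; positivity
  have hlev : ∀ (z : ℤ) (k : ℕ), ¬ (p : ℤ) ∣ z → v ((z : ℝ) * β ^ k) = v β ^ k := by
    intro z k hz; rw [map_mul, hv z hz, one_mul, map_pow]
  have e1 : v (x - x') = v β ^ k := by rw [h1, hlev _ _ hz]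
  have e2 : v (y - y') = v β ^ l := by rw [h2, hlev _ _ hz']
  have : ∃ u ∈ X, v β ^ k ≤ v (u - y) := by
    by_contra hcon
    push Not at hcon
    have a1 := hcon x hx
    have a2 := hcon x' hx'
    have : v ((x - y) - (x' - y)) < v β ^ k := lt_of_le_of_lt (v.map_sub _ _) (max_lt a1 a2)
    rw [sub_sub_sub_cancel_right, e1] at this
    exact lt_irrefl _ this
  obtain ⟨u, hu, huy⟩ := this
  have hlt : v (y - y') < v (u - y) := by rw [e2]; exact lt_of_lt_of_le hkl huy
  have huy' : v (u - y') = v (u - y) := by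
    have := v.map_add_eq_of_lt_right (x := y - y') (y := u - y) hlt
    rwa [show y - y' + (u - y) = u - y' by ring] at this
  have hpos : 0 < v (u - y) := lt_of_le_of_lt zero_le hlt
  have n1 : u ≠ y := by rintro rfl; simp at hpos
  have n2 : u ≠ y' := by rintro rfl; rw [← huy'] at hpos; simp at hpos
  obtain ⟨m, hm, a, ha, hma⟩ := hX u hu y hy n1
  obtain ⟨m', hm', b, hb, hmb⟩ := hX u hu y' hy' n2
  have hmm : m' = m := by
    rw [hma, hmb, hlev _ _ ha, hlev _ _ hb] at huy'
    exact pow_right_injective₀ (zero_lt_iff.mpr hβ0) hvβ huy'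
  subst hmm
  refine ⟨m', hm, ?_, b - a, ?_⟩
  · rwa [hma, hlev _ _ ha] at huy
  · push_cast
    linear_combination hmb - hma

theorem aux_alg {κ : Type*} [Field κ] (p : ℕ) [Fact p.Prime] [CharP κ p] (b : κ) (i j l : ℕ)
    (hij : i ≠ j) (x y z : ℤ) (hx : ¬ (p : ℤ) ∣ x) (hy : ¬ (p : ℤ) ∣ y)
    (h : (x : κ) * b ^ i + y * b ^ j = z * b ^ l) :
    letI := ZMod.algebra κ p
    IsAlgebraic (ZMod p) b := by
  letI := ZMod.algebra κ p
  have hx0 : (x : ZMod p) ≠ 0 := by rwa [Ne, ZMod.intCast_zmod_eq_zero_iff_dvd]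
  have hy0 : (y : ZMod p) ≠ 0 := by rwa [Ne, ZMod.intCast_zmod_eq_zero_iff_dvd]
  refine ⟨Polynomial.C (x : ZMod p) * Polynomial.X ^ i + Polynomial.C (y : ZMod p) * Polynomial.X ^ j
    - Polynomial.C (z : ZMod p) * Polynomial.X ^ l, ?_, ?_⟩
  · intro h0
    by_cases hl : l = i
    · have := congrArg (fun q => Polynomial.coeff q j) h0
      simp only [Polynomial.coeff_sub, Polynomial.coeff_add, Polynomial.coeff_C_mul_X_pow] at this
      subst hl
      simp [hij.symm] at this
      exact hy0 this
    · have := congrArg (fun q => Polynomial.coeff q i) h0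
      simp only [Polynomial.coeff_sub, Polynomial.coeff_add, Polynomial.coeff_C_mul_X_pow] at this
      simp [hij, Ne.symm hl] at this
      exact hx0 this
  · simp [h]

/-- unit case is impossible -/
theorem aux_unit (p : ℕ) (hp : p.Prime) (V : ValuationSubring ℝ)
    (hv : ∀ z : ℤ, (¬ (p : ℤ) ∣ z → V.valuation (z : ℝ) = 1) ∧ ((p : ℤ) ∣ z → V.valuation (z : ℝ) < 1))
    (β : ℝ) (hβ : 1 < β) (hvβ : V.valuation β = 1)
    (X : Set ℝ) (hinf : X.Infinite)
    (hX : ∀ x ∈ X, ∀ y ∈ X, x ≠ y → ∃ k : ℕ, 1 ≤ k ∧ ∃ z : ℤ, ¬ (p : ℤ) ∣ z ∧ x - y = z * β ^ k)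
    (hocc : ∀ k : ℕ, 1 ≤ k → ∃ x ∈ X, ∃ y ∈ X, ∃ z : ℤ, ¬ (p : ℤ) ∣ z ∧ x - y = z * β ^ k) :
    False := by
  haveI : Fact p.Prime := ⟨hp⟩
  have hβV : β ∈ V := by rw [← ValuationSubring.valuation_le_one_iff, hvβ]
  let b : V := ⟨β, hβV⟩
  let r := IsLocalRing.residue V
  have hr0 : ∀ a : V, r a = 0 ↔ V.valuation (a : ℝ) < 1 := by
    intro a
    rw [IsLocalRing.residue_eq_zero_iff, ValuationSubring.valuation_lt_one_iff]
  haveI : CharP (IsLocalRing.ResidueField V) p := by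
    apply (CharP.charP_iff_prime_eq_zero hp).mpr
    have := (hr0 ((p : ℤ) : V)).mpr (by simpa using (hv p).2 dvd_rfl)
    simpa using this
  -- a triangle with two levels
  have key : ∀ u ∈ X, ∀ w ∈ X, ∀ w' ∈ X, ∀ (i j : ℕ) (x y : ℤ), i ≠ j → ¬ (p : ℤ) ∣ x → ¬ (p : ℤ) ∣ y →
      w - u = x * β ^ i → u - w' = y * β ^ j →
      letI := ZMod.algebra (IsLocalRing.ResidueField V) p
      IsAlgebraic (ZMod p) (r b) := by
    intro u hu w hw w' hw' i j x y hij hx hy h1 h2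
    obtain ⟨l, z, hz⟩ : ∃ (l : ℕ) (z : ℤ), w - w' = z * β ^ l := by
      by_cases h : w = w'
      · exact ⟨0, 0, by simp [h]⟩
      · obtain ⟨k, -, z, -, hz⟩ := hX w hw w' hw' h
        exact ⟨k, z, hz⟩
    apply aux_alg p (r b) i j l hij x y z hx hy
    have : (x : V) * b ^ i + y * b ^ j = z * b ^ l := by
      apply Subtype.ext
      push_cast
      linear_combination hz - h1 - h2
    have := congrArg r this
    simpa using this
  letI := ZMod.algebra (IsLocalRing.ResidueField V) p
  have halg : IsAlgebraic (ZMod p) (r b) := by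
    obtain ⟨x, hx, x', hx', z, hz, hxx⟩ := hocc 1 le_rfl
    obtain ⟨y, hy, y', hy', t, ht, hyy⟩ := hocc 2 (by norm_num)
    have main : ∀ x ∈ X, ∀ x' ∈ X, ∀ z : ℤ, ¬ (p : ℤ) ∣ z → x - x' = z * β ^ 1 → x ≠ y →
        IsAlgebraic (ZMod p) (r b) := by
      intro x hx x' hx' z hz hxx hne
      obtain ⟨k, hk, a, ha, hxy⟩ := hX x hx y hy hne
      by_cases hk1 : k = 1
      · subst hk1
        exact key y hy x hx y' hy' 1 2 a t (by norm_num) ha ht hxy hyy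
      · exact key x hx y hy x' hx' k 1 (-a) z hk1 (by rwa [dvd_neg]) hz
          (by push_cast; linear_combination -hxy) hxx
    by_cases h : x = y
    · refine main x' hx' x hx (-z) (by rwa [dvd_neg]) (by push_cast; linear_combination -hxx) ?_
      rintro rfl
      rw [h, sub_self] at hxx
      have : (z : ℝ) ≠ 0 := by
        intro h0; apply hz; have : z = 0 := by exact_mod_cast h0
        simp [this]
      have : (z : ℝ) * β ^ 1 ≠ 0 := by positivity
      exact this hxx.symm
    · exact main x hx x' hx' z hz hxx h
  let L := IntermediateField.adjoin (ZMod p) {r b}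
  haveI : FiniteDimensional (ZMod p) L := IntermediateField.adjoin.finiteDimensional halg.isIntegral
  haveI : Finite L := Module.finite_of_finite (ZMod p)
  obtain ⟨x0, hx0⟩ := hinf.nonempty
  haveI : Infinite X := hinf.to_subtype
  have hmem : ∀ x : X, ∃ a : V, (a : ℝ) = x - x0 ∧ r a ∈ L := by
    rintro ⟨x, hx⟩
    by_cases h : x = x0
    · exact ⟨0, by simp [h], by simp⟩
    · obtain ⟨k, -, z, -, hz⟩ := hX x hx x0 hx0 h
      refine ⟨z * b ^ k, ?_, ?_⟩
      · push_cast; exact hz.symm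
      · rw [map_mul, map_pow, map_intCast]
        exact mul_mem (intCast_mem L z) (pow_mem (IntermediateField.mem_adjoin_simple_self _ _) k)
  choose f hf1 hf2 using hmem
  have hinj : Function.Injective (fun x : X => (⟨r (f x), hf2 x⟩ : L)) := by
    intro x y hxy
    have h1 : r (f x) = r (f y) := congrArg Subtype.val hxy
    by_contra hne
    obtain ⟨k, -, z, hz, hxy⟩ := hX x x.2 y y.2 (fun h => hne (Subtype.ext h))
    have h2 : r (f x - f y) = 0 := by rw [map_sub, h1, sub_self]
    rw [hr0] at h2
    have h3 : ((f x - f y : V) : ℝ) = z * β ^ k := by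
      push_cast; rw [hf1, hf1, ← hxy]; ring
    rw [h3, map_mul, map_pow, hvβ, (hv z).1 hz] at h2
    simp at h2
  exact not_finite_iff_infinite.mpr ‹Infinite X› (Finite.of_injective _ hinj)

theorem aux_arith (p : ℕ) (hp : p.Prime) (β : ℝ) (hβ : 1 < β) (X : Set ℝ)
    (hX : ∀ x ∈ X, ∀ y ∈ X, x ≠ y → ∃ k : ℕ, 1 ≤ k ∧ ∃ z : ℤ, ¬ (p : ℤ) ∣ z ∧ x - y = z * β ^ k)
    (hocc : ∀ k : ℕ, 1 ≤ k → ∃ x ∈ X, ∃ y ∈ X, ∃ z : ℤ, ¬ (p : ℤ) ∣ z ∧ x - y = z * β ^ k) :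
    ∃ s t : ℕ, Nat.Coprime s t ∧ 0 < t ∧ β = s / t ∧ p ∣ s ∧
      ∀ x ∈ X, ∀ y ∈ X, ∀ (k : ℕ) (z : ℤ), 1 ≤ k → ¬ (p : ℤ) ∣ z → x - y = z * β ^ k →
        (s : ℝ) ^ (k - 1) ≤ |x - y| := by
  have hβ0 : 0 < β := by linarith
  have hz1 : ∀ z : ℤ, ¬ (p : ℤ) ∣ z → (1 : ℝ) ≤ |(z : ℝ)| := by
    intro z hz
    have : z ≠ 0 := by rintro rfl; simp at hz
    exact_mod_cast Int.one_le_abs this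
  have hlow : ∀ (z : ℤ) (k : ℕ), z ≠ 0 → β ^ k ≤ |(z : ℝ) * β ^ k| := by
    intro z k hz
    have : (1 : ℝ) ≤ |(z : ℝ)| := by exact_mod_cast Int.one_le_abs hz
    rw [abs_mul, abs_of_pos (pow_pos hβ0 k)]
    nlinarith [pow_pos hβ0 k]
  have hzne : ∀ z : ℤ, ¬ (p : ℤ) ∣ z → z ≠ 0 := by rintro z hz rfl; simp at hz
  have hinf : X.Infinite := by
    intro hfin
    have : (Set.image2 (fun x y => |x - y|) X X).Finite := hfin.image2 _ hfin
    obtain ⟨C, hC⟩ := this.bddAbove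
    obtain ⟨k, hk⟩ := pow_unbounded_of_one_lt C hβ
    obtain ⟨x, hx, y, hy, z, hz, h⟩ := hocc (k + 1) (by omega)
    have h1 : |x - y| ≤ C := hC ⟨x, hx, y, hy, rfl⟩
    have h2 := hlow z (k + 1) (hzne z hz)
    rw [← h] at h2
    have : β ^ k ≤ β ^ (k + 1) := pow_le_pow_right₀ hβ.le (by omega)
    linarith
  obtain ⟨V, hV⟩ := aux_val p hp
  have hβv0 : V.valuation β ≠ 0 := by rw [Ne, map_eq_zero]; positivity
  have hvp : 0 < V.valuation β := zero_lt_iff.mpr hβv0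
  obtain ⟨x, hx, x', hx', z, hz, h1⟩ := hocc 1 le_rfl
  rcases lt_trichotomy (V.valuation β) 1 with hlt | heq | hgt
  · have hw : ∀ y ∈ X, ∀ y' ∈ X, ∀ (k : ℕ) (z' : ℤ), 2 ≤ k → ¬ (p : ℤ) ∣ z' → y - y' = z' * β ^ k →
        ∃ w : ℤ, y - y' = w * β := by
      intro y hy y' hy' k z' hk hz' h2
      obtain ⟨m, hm, hle, w, hw⟩ := aux_tri V.valuation p (fun z => (hV z).1) β hβ hlt.ne X hX
        x x' y y' hx hx' hy hy' 1 k z z' hz hz' h1 h2 (pow_lt_pow_right_of_lt_one₀ hvp hlt (by omega))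
      have hm1 : m = 1 := by
        by_contra hne
        have : V.valuation β ^ m < V.valuation β ^ 1 :=
          pow_lt_pow_right_of_lt_one₀ hvp hlt (by omega)
        exact absurd hle (not_le.mpr this)
      subst hm1
      exact ⟨w, by simpa using hw⟩
    have hrat : ∃ q : ℚ, β = q := by
      obtain ⟨y, hy, y', hy', z', hz', h2⟩ := hocc 2 (by norm_num)
      obtain ⟨w, hw⟩ := hw y hy y' hy' 2 z' le_rfl hz' h2
      have hz0 : (z' : ℝ) ≠ 0 := by exact_mod_cast hzne z' hz'
      refine ⟨w / z', ?_⟩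
      push_cast
      rw [eq_div_iff hz0]
      have : β * (β * z') = β * w := by linear_combination hw - h2
      exact mul_left_cancel₀ hβ0.ne' this
    obtain ⟨q, hq⟩ := hrat
    have hq0 : 0 < q := by rw [hq] at hβ0; exact_mod_cast hβ0
    have hnum : ((q.num.natAbs : ℕ) : ℤ) = q.num := Int.natAbs_of_nonneg (Rat.num_nonneg.mpr hq0.le)
    have hnumR : ((q.num.natAbs : ℕ) : ℝ) = (q.num : ℝ) := by
      conv_rhs => rw [← hnum]
      exact (Int.cast_natCast _).symm
    have hβst : β = (q.num.natAbs : ℝ) / (q.den : ℝ) := by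
      rw [hq, hnumR]; exact Rat.cast_def q
    have hden : (0 : ℝ) < (q.den : ℝ) := by exact_mod_cast q.den_pos
    refine ⟨q.num.natAbs, q.den, q.reduced, q.den_pos, hβst, ?_, ?_⟩
    · by_contra hnd
      have h3 := (hV q.num).1 (by rw [← hnum]; exact_mod_cast hnd)
      have h4 : (q.num : ℝ) = q.den * β := by rw [hβst, hnumR]; field_simp
      rw [h4, map_mul] at h3
      have h5 : V.valuation (q.den : ℝ) ≤ 1 := by
        rw [ValuationSubring.valuation_le_one_iff]; exact natCast_mem V _
      have : V.valuation (q.den : ℝ) * V.valuation β < 1 := by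
        calc _ ≤ 1 * V.valuation β := by gcongr
          _ < 1 := by simpa using hlt
      exact absurd h3 this.ne
    · intro y hy y' hy' k z' hk hz' h2
      rcases Nat.lt_or_ge k 2 with hk2 | hk2
      · have : k = 1 := by omega
        subst this
        have := hlow z' 1 (hzne z' hz')
        rw [← h2] at this
        simp only [Nat.sub_self, pow_zero]
        rw [pow_one] at this
        linarith
      · obtain ⟨w, hw⟩ := hw y hy y' hy' k z' hk2 hz' h2
        obtain ⟨j, rfl⟩ : ∃ j, k = j + 1 := ⟨k - 1, by omega⟩
        simp only [Nat.add_sub_cancel]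
        have h6 : (z' : ℝ) * β ^ j = w := by
          have : β * ((z' : ℝ) * β ^ j) = β * w := by linear_combination hw - h2
          exact mul_left_cancel₀ hβ0.ne' this
        have h7 : (z' : ℝ) * (q.num : ℝ) ^ j = w * (q.den : ℝ) ^ j := by
          rw [← h6, hβst, div_pow, hnumR]
          field_simp
        have h8 : z' * q.num ^ j = w * (q.den : ℤ) ^ j := by exact_mod_cast h7
        have h9 : (q.den : ℤ) ^ j ∣ z' := by
          have hc : IsCoprime ((q.den : ℤ) ^ j) (q.num ^ j) := by
            apply IsCoprime.pow
            rw [Int.isCoprime_iff_nat_coprime]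
            simpa using q.reduced.symm
          exact hc.dvd_of_dvd_mul_right ⟨w, by rw [h8]; ring⟩
        have h10 : (q.den : ℝ) ^ j ≤ |(z' : ℝ)| := by
          have := Int.le_of_dvd (abs_pos.mpr (hzne z' hz')) ((dvd_abs _ _).mpr h9)
          exact_mod_cast this
        rw [h2, abs_mul, abs_of_pos (pow_pos hβ0 _)]
        have h11 : (q.num.natAbs : ℝ) = q.den * β := by rw [hβst]; field_simp
        rw [h11, mul_pow]
        have : β ^ j ≤ β ^ (j + 1) := pow_le_pow_right₀ hβ.le (by omega)
        gcongr
  · exact (aux_unit p hp V hV β hβ heq X hinf hX hocc).elim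
  · exfalso
    obtain ⟨k, hk⟩ := pow_unbounded_of_one_lt |x - x'| hβ
    obtain ⟨y, hy, y', hy', z', hz', h2⟩ := hocc (k + 2) (by omega)
    obtain ⟨m, hm, hle, w, hw⟩ := aux_tri V.valuation p (fun z => (hV z).1) β hβ hgt.ne' X hX
        y y' x x' hy hy' hx hx' (k + 2) 1 z' z hz' hz h2 h1 (pow_lt_pow_right₀ hgt (by omega))
    have hkm : k + 2 ≤ m := (pow_le_pow_iff_right₀ hgt).mp hle
    have hw0 : w ≠ 0 := by
      rintro rfl
      have := hlow z 1 (hzne z hz)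
      rw [← h1, hw] at this
      simp at this
      linarith
    have := hlow w m hw0
    rw [← hw] at this
    have : β ^ k ≤ β ^ m := pow_le_pow_right₀ hβ.le (by omega)
    linarith

/-- The map `ξ ↦ M^{-T} ξ`. -/
def affA (ρ₁ ρ₂ c : ℝ) (ξ : Fin 2 → ℝ) : Fin 2 → ℝ :=
  ![ρ₁ * ξ 0, ρ₂ * ξ 1 - c * ρ₁ * ρ₂ * ξ 0]

theorem affA_iter_zero (ρ₁ ρ₂ c : ℝ) (k : ℕ) (ξ : Fin 2 → ℝ) :
    ((affA ρ₁ ρ₂ c)^[k] ξ) 0 = ρ₁ ^ k * ξ 0 := by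
  induction k with
  | zero => simp
  | succ k ih =>
    rw [Function.iterate_succ_apply']
    conv_lhs => rw [affA]
    simp only [Matrix.cons_val_zero]
    rw [ih]; ring

theorem affA_tendsto (ρ₁ ρ₂ c : ℝ) (hρ10 : 0 < ρ₁) (hρ11 : ρ₁ < 1) (hρ20 : 0 < ρ₂) (hρ21 : ρ₂ < 1)
    (ξ : Fin 2 → ℝ) :
    Filter.Tendsto (fun k => (affA ρ₁ ρ₂ c)^[k] ξ) Filter.atTop (nhds 0) := by
  obtain ⟨r, hr1, hr2⟩ := exists_between (max_lt hρ11 hρ21)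
  have h1 : ρ₁ < r := lt_of_le_of_lt (le_max_left _ _) hr1
  have h2 : ρ₂ < r := lt_of_le_of_lt (le_max_right _ _) hr1
  have hr0 : 0 < r := by linarith
  have hrt : Filter.Tendsto (fun k : ℕ => r ^ k) Filter.atTop (nhds 0) :=
    tendsto_pow_atTop_nhds_zero_of_lt_one hr0.le hr2
  let C := |c * ρ₁ * ρ₂ * ξ 0|
  let K := |ξ 1| + C / (r - ρ₂)
  have hC : 0 ≤ C := abs_nonneg _
  have hK1 : |ξ 1| ≤ K := by
    have : 0 ≤ C / (r - ρ₂) := div_nonneg hC (by linarith)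
    simp only [K]; linarith
  have hK2 : C ≤ K * (r - ρ₂) := by
    have h3 : C / (r - ρ₂) * (r - ρ₂) = C := by
      have : r - ρ₂ ≠ 0 := by linarith
      field_simp
    have : 0 ≤ |ξ 1| * (r - ρ₂) := mul_nonneg (abs_nonneg _) (by linarith)
    simp only [K]; nlinarith
  have hK0 : 0 ≤ K := le_trans (abs_nonneg _) hK1
  have hb : ∀ k : ℕ, |((affA ρ₁ ρ₂ c)^[k] ξ) 1| ≤ K * r ^ k := by
    intro k
    induction k with
    | zero => simpa using hK1
    | succ k ih =>
      have e : ((affA ρ₁ ρ₂ c)^[k+1] ξ) 1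
          = ρ₂ * ((affA ρ₁ ρ₂ c)^[k] ξ) 1 - (c * ρ₁ * ρ₂ * ξ 0) * ρ₁ ^ k := by
        rw [Function.iterate_succ_apply']
        have := affA_iter_zero ρ₁ ρ₂ c k ξ
        conv_lhs => rw [affA]
        simp only [Matrix.cons_val_one]
        rw [this]; simp; ring
      rw [e]
      have hp : ρ₁ ^ k ≤ r ^ k := pow_le_pow_left₀ hρ10.le h1.le k
      calc _ ≤ |ρ₂ * ((affA ρ₁ ρ₂ c)^[k] ξ) 1| + |(c * ρ₁ * ρ₂ * ξ 0) * ρ₁ ^ k| := abs_sub _ _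
        _ = ρ₂ * |((affA ρ₁ ρ₂ c)^[k] ξ) 1| + C * ρ₁ ^ k := by
          rw [abs_mul, abs_of_pos hρ20, abs_mul _ (ρ₁ ^ k), abs_of_pos (pow_pos hρ10 k)]
        _ ≤ ρ₂ * (K * r ^ k) + (K * (r - ρ₂)) * r ^ k := by gcongr
        _ = K * r ^ (k + 1) := by ring
  rw [tendsto_pi_nhds]
  intro i
  fin_cases i
  · simp only [Fin.zero_eta, Pi.zero_apply]
    simp_rw [affA_iter_zero]
    have := (tendsto_pow_atTop_nhds_zero_of_lt_one hρ10.le hρ11).mul_const (ξ 0)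
    simpa using this
  · simp only [Fin.mk_one, Pi.zero_apply]
    refine squeeze_zero_norm (a := fun k => K * r ^ k) (fun k => by simpa using hb k) ?_
    simpa using hrt.const_mul K

theorem expChar_norm (l x : Fin 2 → ℝ) : ‖expChar l x‖ = 1 := by
  unfold expChar
  rw [show (-2 * Real.pi * Complex.I) * ((l 0 * x 0 + l 1 * x 1 : ℝ) : ℂ)
    = ((-2 * Real.pi * (l 0 * x 0 + l 1 * x 1) : ℝ) : ℂ) * Complex.I by push_cast; ring]
  exact Complex.norm_exp_ofReal_mul_I _

theorem expChar_add_right (l x y : Fin 2 → ℝ) : expChar l (x + y) = expChar l x * expChar l y := by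
  unfold expChar
  rw [← Complex.exp_add]
  congr 1
  simp only [Pi.add_apply]
  push_cast; ring

theorem expChar_conj_mul (l m x : Fin 2 → ℝ) :
    expChar m x * (starRingEnd ℂ) (expChar l x) = expChar (m - l) x := by
  unfold expChar
  rw [← Complex.exp_conj, ← Complex.exp_add]
  congr 1
  simp only [map_mul, map_neg, Complex.conj_ofReal, Complex.conj_I, Pi.sub_apply, map_ofNat]
  push_cast; ring

theorem expChar_continuous : Continuous (fun q : (Fin 2 → ℝ) × (Fin 2 → ℝ) => expChar q.1 q.2) := by
  unfold expChar
  fun_prop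

theorem expChar_affA (ρ₁ ρ₂ c : ℝ) (ξ x : Fin 2 → ℝ) :
    expChar (affA ρ₁ ρ₂ c ξ) x =
      expChar ξ ![ρ₁ * x 0 - c * ρ₁ * ρ₂ * x 1, ρ₂ * x 1] := by
  unfold expChar affA
  congr 2
  simp only [Matrix.cons_val_zero, Matrix.cons_val_one]
  norm_cast
  ring

theorem expChar_iter (ρ₁ ρ₂ c : ℝ) (k : ℕ) (x : Fin 2 → ℝ) :
    ∃ y, ∀ ξ, expChar ((affA ρ₁ ρ₂ c)^[k] ξ) x = expChar ξ y := by
  induction k with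
  | zero => exact ⟨x, fun ξ => rfl⟩
  | succ k ih =>
    obtain ⟨y, hy⟩ := ih
    exact ⟨_, fun ξ => by rw [Function.iterate_succ_apply, hy, expChar_affA]⟩

theorem Mupper_inv (ρ₁ ρ₂ c : ℝ) (h1 : ρ₁ ≠ 0) (h2 : ρ₂ ≠ 0) (x : Fin 2 → ℝ) :
    (Mupper ρ₁ ρ₂ c)⁻¹.mulVec x = ![ρ₁ * x 0 - c * ρ₁ * ρ₂ * x 1, ρ₂ * x 1] := by
  have : (Mupper ρ₁ ρ₂ c)⁻¹ = !![ρ₁, - c * ρ₁ * ρ₂; 0, ρ₂] := by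
    apply Matrix.inv_eq_right_inv
    unfold Mupper
    ext i j
    fin_cases i <;> fin_cases j <;> simp [Matrix.mul_apply, Fin.sum_univ_two, h1, h2]
    field_simp
    ring
  rw [this]
  ext i
  fin_cases i <;> simp [Matrix.mulVec, dotProduct, Fin.sum_univ_two]
  ring

theorem expChar_integrable (μ : Measure (Fin 2 → ℝ)) [IsProbabilityMeasure μ] (ξ : Fin 2 → ℝ) :
    Integrable (fun x => expChar ξ x) μ := by
  refine Integrable.of_bound (C := 1) ?_ ?_
  · exact (expChar_continuous.comp (Continuous.prodMk_right ξ)).aestronglyMeasurable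
  · exact Filter.Eventually.of_forall fun x => (expChar_norm ξ x).le

theorem ft_norm_le (μ : Measure (Fin 2 → ℝ)) [IsProbabilityMeasure μ] (ξ : Fin 2 → ℝ) :
    ‖ftMeasure μ ξ‖ ≤ 1 := by
  unfold ftMeasure
  have := norm_integral_le_of_norm_le_const (μ := μ) (f := fun x => expChar ξ x) (C := 1)
    (Filter.Eventually.of_forall fun x => (expChar_norm ξ x).le)
  simpa using this

theorem ft_zero (μ : Measure (Fin 2 → ℝ)) [IsProbabilityMeasure μ] : ftMeasure μ 0 = 1 := by
  unfold ftMeasure expChar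
  simp

theorem ft_continuous (μ : Measure (Fin 2 → ℝ)) [IsProbabilityMeasure μ] :
    Continuous (ftMeasure μ) := by
  unfold ftMeasure
  refine continuous_of_dominated (bound := fun _ => 1) ?_ ?_ (integrable_const _) ?_
  · intro ξ
    exact (expChar_continuous.comp (Continuous.prodMk_right ξ)).aestronglyMeasurable
  · intro ξ
    exact Filter.Eventually.of_forall fun x => (expChar_norm ξ x).le
  · exact Filter.Eventually.of_forall fun x => expChar_continuous.comp (Continuous.prodMk_left x)

theorem mask_norm_le {p : ℕ} (hp : 0 < p) (D : Fin p → (Fin 2 → ℝ)) (ξ : Fin 2 → ℝ) :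
    ‖mask D ξ‖ ≤ 1 := by
  unfold mask
  rw [norm_mul, norm_inv, Complex.norm_natCast]
  have : ‖∑ i : Fin p, expChar ξ (D i)‖ ≤ p := by
    refine (norm_sum_le _ _).trans ?_
    simp [expChar_norm]
  have hp' : (0 : ℝ) < p := by exact_mod_cast hp
  rw [inv_mul_le_iff₀ hp']
  simpa using this

theorem ft_step {p : ℕ} (hp : 0 < p) (ρ₁ ρ₂ c : ℝ) (h1 : ρ₁ ≠ 0) (h2 : ρ₂ ≠ 0)
    (D : Fin p → (Fin 2 → ℝ)) (μ : Measure (Fin 2 → ℝ)) (hμ : IsSelfAffine μ (Mupper ρ₁ ρ₂ c) D)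
    (ξ : Fin 2 → ℝ) :
    ftMeasure μ ξ = mask D (affA ρ₁ ρ₂ c ξ) * ftMeasure μ (affA ρ₁ ρ₂ c ξ) := by
  obtain ⟨hprob, -, hself⟩ := hμ
  have hmeas : ∀ i, Measurable (fun x : Fin 2 → ℝ => (Mupper ρ₁ ρ₂ c)⁻¹.mulVec (x + D i)) := by
    intro i
    apply Continuous.measurable
    fun_prop
  have hprob2 : ∀ i, IsProbabilityMeasure
      (μ.map (fun x : Fin 2 → ℝ => (Mupper ρ₁ ρ₂ c)⁻¹.mulVec (x + D i))) := fun i =>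
    Measure.isProbabilityMeasure_map (hmeas i).aemeasurable
  have e : ftMeasure μ ξ = ∫ x, expChar ξ x ∂((p : ℝ≥0∞)⁻¹ • ∑ i : Fin p,
      μ.map (fun x => (Mupper ρ₁ ρ₂ c)⁻¹.mulVec (x + D i))) := by
    rw [← hself]; rfl
  rw [e, integral_smul_measure, integral_finsetSum_measure (fun i _ => expChar_integrable _ ξ)]
  have hi : ∀ i, ∫ x, expChar ξ x ∂(μ.map (fun x => (Mupper ρ₁ ρ₂ c)⁻¹.mulVec (x + D i)))
      = expChar (affA ρ₁ ρ₂ c ξ) (D i) * ftMeasure μ (affA ρ₁ ρ₂ c ξ) := by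
    intro i
    have hsm : AEStronglyMeasurable (fun x => expChar ξ x)
        (μ.map (fun x => (Mupper ρ₁ ρ₂ c)⁻¹.mulVec (x + D i))) :=
      (expChar_continuous.comp (Continuous.prodMk_right ξ)).aestronglyMeasurable
    rw [integral_map (hmeas i).aemeasurable hsm]
    unfold ftMeasure
    rw [← integral_const_mul]
    congr 1
    ext x
    rw [Mupper_inv _ _ _ h1 h2, ← expChar_affA, expChar_add_right, mul_comm]
  simp_rw [hi]
  rw [← Finset.sum_mul]
  unfold mask
  simp [ENNReal.toReal_inv, mul_assoc]

theorem ft_iter {p : ℕ} (hp : 0 < p) (ρ₁ ρ₂ c : ℝ) (h1 : ρ₁ ≠ 0) (h2 : ρ₂ ≠ 0)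
    (D : Fin p → (Fin 2 → ℝ)) (μ : Measure (Fin 2 → ℝ)) (hμ : IsSelfAffine μ (Mupper ρ₁ ρ₂ c) D)
    (m : ℕ) (ξ : Fin 2 → ℝ) :
    ftMeasure μ ξ = (∏ k ∈ Finset.Icc 1 m, mask D ((affA ρ₁ ρ₂ c)^[k] ξ))
      * ftMeasure μ ((affA ρ₁ ρ₂ c)^[m] ξ) := by
  induction m with
  | zero => simp
  | succ m ih =>
    rw [ih, Finset.prod_Icc_succ_top (by omega), ft_step hp ρ₁ ρ₂ c h1 h2 D μ hμ,
      ← Function.iterate_succ_apply' (affA ρ₁ ρ₂ c)]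
    ring

theorem ft_ne_zero {p : ℕ} (hp : 0 < p) (ρ₁ ρ₂ c : ℝ) (hρ10 : 0 < ρ₁) (hρ11 : ρ₁ < 1)
    (hρ20 : 0 < ρ₂) (hρ21 : ρ₂ < 1)
    (D : Fin p → (Fin 2 → ℝ)) (μ : Measure (Fin 2 → ℝ)) (hμ : IsSelfAffine μ (Mupper ρ₁ ρ₂ c) D)
    (ξ : Fin 2 → ℝ) (h : ftMeasure μ ξ = 0) :
    ∃ k : ℕ, 1 ≤ k ∧ mask D ((affA ρ₁ ρ₂ c)^[k] ξ) = 0 := by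
  have := hμ.1
  have ht : Filter.Tendsto (fun k => ftMeasure μ ((affA ρ₁ ρ₂ c)^[k] ξ)) Filter.atTop (nhds 1) := by
    rw [← ft_zero μ]
    exact (ft_continuous μ).continuousAt.tendsto.comp
      (affA_tendsto ρ₁ ρ₂ c hρ10 hρ11 hρ20 hρ21 ξ)
  obtain ⟨m, hm⟩ := (ht.eventually_ne one_ne_zero).exists
  rw [ft_iter hp ρ₁ ρ₂ c hρ10.ne' hρ20.ne' D μ hμ m ξ] at h
  have h3 := (mul_eq_zero.mp h).resolve_right hm
  obtain ⟨k, hk, hk2⟩ := Finset.prod_eq_zero_iff.mp h3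
  exact ⟨k, (Finset.mem_Icc.mp hk).1, hk2⟩

theorem prod_rep {p : ℕ} (hp : 0 < p) (ρ₁ ρ₂ c : ℝ) (D : Fin p → (Fin 2 → ℝ)) (T : Finset ℕ) :
    ∃ (n : ℕ) (x : Fin n → (Fin 2 → ℝ)), 0 < n ∧ ∀ ξ,
      ∏ k ∈ T, mask D ((affA ρ₁ ρ₂ c)^[k] ξ) = (n : ℂ)⁻¹ * ∑ i, expChar ξ (x i) := by
  induction T using Finset.induction_on with
  | empty => exact ⟨1, fun _ => 0, one_pos, fun ξ => by simp [expChar]⟩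
  | insert k T hk ih =>
    obtain ⟨n, x, hn, hx⟩ := ih
    choose y hy using fun i => expChar_iter ρ₁ ρ₂ c k (D i)
    refine ⟨p * n, fun i => y (finProdFinEquiv.symm i).1 + x (finProdFinEquiv.symm i).2,
      Nat.mul_pos hp hn, fun ξ => ?_⟩
    rw [Finset.prod_insert hk, hx]
    rw [← finProdFinEquiv.sum_comp, Fintype.sum_prod_type]
    simp only [Equiv.symm_apply_apply, expChar_add_right]
    unfold mask
    simp_rw [hy, ← Finset.mul_sum, ← Finset.sum_mul]
    push_cast
    rw [mul_inv]
    ring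

theorem bessel {p : ℕ} (hp : 0 < p) (ρ₁ ρ₂ c : ℝ) (D : Fin p → (Fin 2 → ℝ)) (T : Finset ℕ)
    (F : Finset (Fin 2 → ℝ))
    (hF : ∀ l ∈ F, ∀ l' ∈ F, l ≠ l' → ∃ k ∈ T, mask D ((affA ρ₁ ρ₂ c)^[k] (l - l')) = 0)
    (ξ : Fin 2 → ℝ) :
    ∑ l ∈ F, ‖∏ k ∈ T, mask D ((affA ρ₁ ρ₂ c)^[k] (ξ - l))‖ ^ 2 ≤ 1 := by
  obtain ⟨n, x, hn, hx⟩ := prod_rep hp ρ₁ ρ₂ c D T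
  have hn' : (0 : ℝ) < n := by exact_mod_cast hn
  let v : (Fin 2 → ℝ) → EuclideanSpace ℂ (Fin n) := fun l =>
    WithLp.toLp 2 (fun i => ((Real.sqrt n)⁻¹ : ℂ) * expChar l (x i))
  have hs : ((Real.sqrt n : ℂ))⁻¹ * ((Real.sqrt n : ℂ))⁻¹ = (n : ℂ)⁻¹ := by
    rw [← mul_inv, ← Complex.ofReal_mul, Real.mul_self_sqrt hn'.le]; simp
  have hinner : ∀ l m, inner ℂ (v l) (v m) = ∏ k ∈ T, mask D ((affA ρ₁ ρ₂ c)^[k] (m - l)) := by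
    intro l m
    rw [hx, PiLp.inner_apply, Finset.mul_sum]
    refine Finset.sum_congr rfl fun i _ => ?_
    rw [RCLike.inner_apply, ← expChar_conj_mul, ← hs]
    simp only [v, map_mul, map_inv₀, Complex.conj_ofReal]
    ring
  have hself : ∀ l, ‖v l‖ = 1 := by
    intro l
    have h1 : inner ℂ (v l) (v l) = 1 := by
      rw [hinner, hx]
      simp [expChar, hn.ne']
    have h2 := inner_self_eq_norm_sq_to_K (𝕜 := ℂ) (v l)
    rw [h1] at h2
    have h3 : ‖v l‖ ^ 2 = 1 := by exact Complex.ofReal_injective (by push_cast; exact h2.symm)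
    have := norm_nonneg (v l)
    nlinarith
  have hon : Orthonormal ℂ (fun l : F => v l) := by
    refine ⟨fun l => hself l, ?_⟩
    intro l m hlm
    change inner ℂ (v l) (v m) = 0
    rw [hinner]
    obtain ⟨k, hk, hk0⟩ := hF m m.2 l l.2 (fun h => hlm (Subtype.ext h.symm))
    exact Finset.prod_eq_zero hk hk0
  have hb := hon.sum_inner_products_le (x := v ξ) (s := Finset.univ)
  rw [hself ξ, one_pow] at hb
  rw [← Finset.sum_coe_sort F]
  refine le_trans (le_of_eq ?_) hb
  refine Finset.sum_congr rfl fun l _ => ?_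
  rw [hinner]

theorem parseval (μ : Measure (Fin 2 → ℝ)) [IsProbabilityMeasure μ] (Λ : Set (Fin 2 → ℝ))
    (b : HilbertBasis Λ ℂ (Lp ℂ 2 μ)) (hb : ∀ lam : Λ, ⇑(b lam) =ᵐ[μ] expChar (lam : Fin 2 → ℝ)) :
    (∀ l ∈ Λ, ∀ l' ∈ Λ, l ≠ l' → ftMeasure μ (l - l') = 0) ∧
    ∀ ξ, HasSum (fun l : Λ => ‖ftMeasure μ (ξ - l)‖ ^ 2) 1 := by
  have hmem : ∀ ξ, MemLp (expChar ξ) 2 μ := fun ξ =>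
    MemLp.of_bound ((expChar_continuous.comp (Continuous.prodMk_right ξ)).aestronglyMeasurable) 1
      (Filter.Eventually.of_forall fun x => (expChar_norm ξ x).le)
  have hin : ∀ (f g : Lp ℂ 2 μ) (l m : Fin 2 → ℝ), ⇑f =ᵐ[μ] expChar l → ⇑g =ᵐ[μ] expChar m →
      inner ℂ f g = ftMeasure μ (m - l) := by
    intro f g l m hf hg
    rw [MeasureTheory.L2.inner_def]
    unfold ftMeasure
    apply integral_congr_ae
    filter_upwards [hf, hg] with x h1 h2
    rw [h1, h2, RCLike.inner_apply, expChar_conj_mul]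
  refine ⟨?_, ?_⟩
  · intro l hl l' hl' hne
    have : inner ℂ (b ⟨l', hl'⟩) (b ⟨l, hl⟩) = 0 := b.orthonormal.2 (i := ⟨l', hl'⟩) (j := ⟨l, hl⟩) (fun h => hne (congrArg Subtype.val h).symm)
    rwa [hin _ _ _ _ (hb _) (hb _)] at this
  · intro ξ
    let f : Lp ℂ 2 μ := (hmem ξ).toLp _
    have hf : ⇑f =ᵐ[μ] expChar ξ := (hmem ξ).coeFn_toLp
    have h := b.hasSum_inner_mul_inner f f
    have h1 : inner ℂ f f = (1 : ℂ) := by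
      rw [hin f f ξ ξ hf hf, sub_self, ft_zero]
    rw [h1] at h
    have h2 : ∀ l : Λ, inner ℂ f (b l) * inner ℂ (b l) f = ((‖ftMeasure μ (ξ - l)‖ ^ 2 : ℝ) : ℂ) := by
      intro l
      rw [← inner_conj_symm, hin _ _ _ _ (hb l) hf, mul_comm, Complex.mul_conj, Complex.normSq_eq_norm_sq]
    simp_rw [h2] at h
    exact (Complex.hasSum_ofReal (f := fun l : Λ => ‖ftMeasure μ (ξ - l)‖ ^ 2) (x := 1)).mp (by simpa using h)

theorem norm_one_add_expChar (η d : Fin 2 → ℝ) (hd : d 1 = 0) :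
    ‖1 + expChar η d‖ = 2 * |Real.cos (Real.pi * (d 0 * η 0))| := by
  have : 1 + expChar η d = Complex.exp (((-(Real.pi * (d 0 * η 0)) : ℝ) : ℂ) * Complex.I)
      * ((2 * Real.cos (Real.pi * (d 0 * η 0)) : ℝ) : ℂ) := by
    unfold expChar
    rw [hd]
    push_cast
    rw [Complex.cos, mul_div_cancel₀ _ (two_ne_zero), mul_add (Complex.exp _) (Complex.exp _), ← Complex.exp_add, ← Complex.exp_add]
    rw [show (-(Real.pi * (d 0 * η 0) : ℂ)) * Complex.I + Real.pi * (d 0 * η 0) * Complex.I = 0 by ring,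
      Complex.exp_zero]
    congr 2
    ring
  rw [this, norm_mul, Complex.norm_exp_ofReal_mul_I, one_mul, Complex.norm_real, Real.norm_eq_abs,
    abs_mul, abs_two]

theorem abs_cos_le (x δ : ℝ) (hδ0 : 0 < δ) (hx : δ ≤ |x - round x|) :
    |Real.cos (Real.pi * x)| ≤ Real.cos (Real.pi * δ) := by
  have h1 : |x - round x| ≤ 1 / 2 := abs_sub_round x
  have h2 : |Real.cos (Real.pi * x)| = |Real.cos (Real.pi * |x - round x|)| := by
    have e : Real.pi * (x - round x) = Real.pi * x - (round x : ℤ) * Real.pi := by ring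
    have : Real.cos (Real.pi * |x - round x|) = Real.cos (Real.pi * (x - round x)) := by
      rw [← Real.cos_abs (Real.pi * (x - round x)), abs_mul, abs_of_pos Real.pi_pos]
    rw [this, e, Real.cos_sub_int_mul_pi, abs_mul]
    simp [abs_zpow]
  have hpi := Real.pi_pos
  have h3 : 0 ≤ Real.cos (Real.pi * |x - round x|) := by
    apply Real.cos_nonneg_of_neg_pi_div_two_le_of_le
    · have := abs_nonneg (x - round x); nlinarith
    · nlinarith
  rw [h2, abs_of_nonneg h3]
  apply Real.cos_le_cos_of_nonneg_of_le_pi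
  · positivity
  · nlinarith
  · gcongr

theorem mask_bound {p : ℕ} (hp : p.Prime) (D : Fin p → (Fin 2 → ℝ)) (hD0 : D ⟨0, hp.pos⟩ = 0)
    (hD11 : D ⟨1, hp.one_lt⟩ 1 = 0) (δ : ℝ) (hδ0 : 0 < δ) (hδ : δ ≤ 1 / 2) :
    ∃ c : ℝ, 0 ≤ c ∧ c < 1 ∧ ∀ η : Fin 2 → ℝ,
      δ ≤ |D ⟨1, hp.one_lt⟩ 0 * η 0 - round (D ⟨1, hp.one_lt⟩ 0 * η 0)| → ‖mask D η‖ ≤ c := by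
  have hp' : (2 : ℝ) ≤ p := by exact_mod_cast hp.two_le
  have hp0 : (0 : ℝ) < p := by linarith
  have hpi := Real.pi_pos
  have hc1 : Real.cos (Real.pi * δ) < 1 := by
    rw [← Real.cos_zero]
    apply Real.cos_lt_cos_of_nonneg_of_le_pi le_rfl
    · nlinarith
    · positivity
  have hc0 : 0 ≤ Real.cos (Real.pi * δ) := by
    apply Real.cos_nonneg_of_neg_pi_div_two_le_of_le <;> nlinarith
  refine ⟨(p : ℝ)⁻¹ * (2 * Real.cos (Real.pi * δ) + (p - 2)), ?_, ?_, ?_⟩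
  · have : 0 ≤ 2 * Real.cos (Real.pi * δ) + (p - 2) := by linarith
    positivity
  · rw [inv_mul_lt_iff₀ hp0]; linarith
  · intro η hη
    unfold mask
    rw [norm_mul, norm_inv, Complex.norm_natCast]
    have hne : (⟨1, hp.one_lt⟩ : Fin p) ∈ (Finset.univ.erase (⟨0, hp.pos⟩ : Fin p)) := by simp
    rw [← Finset.add_sum_erase _ _ (Finset.mem_univ (⟨0, hp.pos⟩ : Fin p)),
      ← Finset.add_sum_erase _ _ hne, ← add_assoc]
    have h0 : expChar η (D ⟨0, hp.pos⟩) = 1 := by rw [hD0]; simp [expChar]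
    rw [h0]
    have h1 := norm_one_add_expChar η (D ⟨1, hp.one_lt⟩) hD11
    have h2 := abs_cos_le _ δ hδ0 hη
    have h3 : ‖∑ i ∈ (Finset.univ.erase (⟨0, hp.pos⟩ : Fin p)).erase ⟨1, hp.one_lt⟩,
        expChar η (D i)‖ ≤ (p : ℝ) - 2 := by
      refine (norm_sum_le _ _).trans ?_
      simp only [expChar_norm, Finset.sum_const, nsmul_eq_mul, mul_one]
      rw [Finset.card_erase_of_mem hne, Finset.card_erase_of_mem (Finset.mem_univ _),
        Finset.card_univ, Fintype.card_fin]
      have := hp.two_le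
      rw [show p - 1 - 1 = p - 2 by omega]
      push_cast [this]
      exact le_rfl
    gcongr
    refine (norm_add_le _ _).trans ?_
    rw [h1]
    linarith

theorem aux_bad (s t : ℕ) (hst : Nat.Coprime s t) (hs : 0 < s) (ht : 0 < t) (β : ℝ)
    (hβ : β = s / t) (y : ℝ) (L : ℕ) (h1 : 1 ≤ |y / β ^ L|) (h2 : |y / β ^ L| < (t : ℝ) ^ L - 1 / 2) :
    ∃ k ≤ L, 1 / ((s : ℝ) + t) ≤ |y / β ^ k - round (y / β ^ k)| := by
  by_contra hcon
  push Not at hcon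
  have hs' : (0 : ℝ) < s := by exact_mod_cast hs
  have ht' : (0 : ℝ) < t := by exact_mod_cast ht
  have hβ0 : 0 < β := by rw [hβ]; positivity
  let n : ℕ → ℤ := fun k => round (y / β ^ k)
  have hstep : ∀ k < L, (s : ℤ) * n (k + 1) = t * n k := by
    intro k hk
    have a1 := hcon k (by omega)
    have a2 := hcon (k + 1) (by omega)
    have e : (s : ℝ) * (y / β ^ (k + 1)) = t * (y / β ^ k) := by
      rw [pow_succ, hβ]; field_simp
    have hlt : |((s * n (k + 1) - t * n k : ℤ) : ℝ)| < 1 := by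
      have e2 : ((s * n (k + 1) - t * n k : ℤ) : ℝ)
          = t * (y / β ^ k - round (y / β ^ k)) - s * (y / β ^ (k+1) - round (y / β ^ (k+1))) := by
        push_cast
        simp only [n]
        linear_combination e
      rw [e2]
      calc _ ≤ |t * (y / β ^ k - round (y / β ^ k))| + |s * (y / β ^ (k+1) - round (y / β ^ (k+1)))| :=
            abs_sub _ _
        _ = t * |y / β ^ k - round (y / β ^ k)| + s * |y / β ^ (k+1) - round (y / β ^ (k+1))| := by
            rw [abs_mul, abs_mul, abs_of_pos hs', abs_of_pos ht']
        _ < t * (1 / ((s : ℝ) + t)) + s * (1 / ((s : ℝ) + t)) := by gcongr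
        _ = 1 := by field_simp; ring
    have : |(s * n (k + 1) - t * n k : ℤ)| < 1 := by exact_mod_cast hlt
    have := Int.abs_lt_one_iff.mp this
    linarith
  have hpow : ∀ k ≤ L, (s : ℤ) ^ k * n k = t ^ k * n 0 := by
    intro k
    induction k with
    | zero => simp
    | succ k ih =>
      intro hk
      have := ih (by omega)
      have h3 := hstep k (by omega)
      linear_combination (s : ℤ) ^ k * h3 + t * this
  have hdvd : (t : ℤ) ^ L ∣ n L := by
    have hc : IsCoprime ((t : ℤ) ^ L) ((s : ℤ) ^ L) := by
      apply IsCoprime.pow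
      rw [Nat.isCoprime_iff_coprime]
      exact hst.symm
    exact hc.dvd_of_dvd_mul_left ⟨n 0, hpow L le_rfl⟩
  have hr : |y / β ^ L - n L| ≤ 1 / 2 := abs_sub_round _
  have hn0 : n L ≠ 0 := by
    intro h0
    rw [h0] at hr
    simp only [Int.cast_zero, sub_zero] at hr
    linarith
  have h3 : (t : ℝ) ^ L ≤ |(n L : ℝ)| := by
    have := Int.le_of_dvd (abs_pos.mpr hn0) ((dvd_abs _ _).mpr hdvd)
    exact_mod_cast this
  have h4 : |(n L : ℝ)| ≤ |y / β ^ L| + |y / β ^ L - n L| := by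
    have := abs_sub (y / β ^ L) (y / β ^ L - n L)
    rwa [sub_sub_cancel] at this
  linarith

theorem decay {p : ℕ} (hp : p.Prime) (ρ₁ ρ₂ c : ℝ) (hρ10 : 0 < ρ₁) (hρ11 : ρ₁ < 1)
    (hρ20 : 0 < ρ₂)
    (D : Fin p → (Fin 2 → ℝ)) (μ : Measure (Fin 2 → ℝ)) (hμ : IsSelfAffine μ (Mupper ρ₁ ρ₂ c) D)
    (hD0 : D ⟨0, hp.pos⟩ = 0) (hD11 : D ⟨1, hp.one_lt⟩ 1 = 0) (hD1 : 1 ≤ |D ⟨1, hp.one_lt⟩ 0|)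
    (s t : ℕ) (hst : Nat.Coprime s t) (ht : 2 ≤ t) (hβ : ρ₁⁻¹ = s / t) :
    ∃ (q : ℝ) (A : ℕ), 0 ≤ q ∧ q < 1 ∧ 2 ≤ A ∧ ∀ (n : ℕ) (η : Fin 2 → ℝ),
      ρ₁⁻¹ ^ (A ^ n) ≤ |η 0| → ‖ftMeasure μ η‖ ≤ q ^ n := by
  have := hμ.1
  set β := ρ₁⁻¹ with hβdef
  set d := D ⟨1, hp.one_lt⟩ 0 with hd
  have hβ1 : 1 < β := (one_lt_inv₀ hρ10).mpr hρ11
  have hβ0 : 0 < β := by linarith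
  have hs : 0 < s := by
    rcases Nat.eq_zero_or_pos s with h | h
    · rw [h] at hβ; simp at hβ; linarith
    · exact h
  have ht' : (2 : ℝ) ≤ t := by exact_mod_cast ht
  have hs' : (0 : ℝ) < s := by exact_mod_cast hs
  obtain ⟨q, hq0, hq1, hq⟩ := mask_bound hp D hD0 hD11 (1 / ((s : ℝ) + t)) (by positivity) (by
    apply one_div_le_one_div_of_le <;> linarith)
  obtain ⟨r, hr⟩ := pow_unbounded_of_one_lt (|d| * β ^ 2 + 1) (show (1 : ℝ) < t by linarith)
  have hd0 : 0 < |d| := by linarith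
  -- one gain
  have gain : ∀ (m : ℕ) (η : Fin 2 → ℝ), 1 ≤ m → β ^ ((r + 2) * m) ≤ |η 0| →
      ∃ k, 1 ≤ k ∧ ‖mask D ((affA ρ₁ ρ₂ c)^[k] η)‖ ≤ q ∧ β ^ m ≤ |((affA ρ₁ ρ₂ c)^[k] η) 0| := by
    intro m η hm hη
    have hcoord : ∀ k, ((affA ρ₁ ρ₂ c)^[k] η) 0 = η 0 / β ^ k := by
      intro k
      rw [affA_iter_zero, hβdef, inv_pow, div_inv_eq_mul, mul_comm]
    have hle : β ^ m ≤ |η 0| :=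
      le_trans (pow_le_pow_right₀ hβ1.le (by nlinarith)) hη
    obtain ⟨L, hL1, hL2⟩ := exists_nat_pow_near (x := |η 0| / β ^ m) (y := β)
      (by rw [le_div_iff₀ (by positivity)]; linarith) hβ1
    rw [le_div_iff₀ (by positivity), ← pow_add] at hL1
    rw [div_lt_iff₀ (by positivity), ← pow_add] at hL2
    have hLm : (r + 2) * m < L + 1 + m := (pow_lt_pow_iff_right₀ hβ1).mp (lt_of_le_of_lt hη hL2)
    have hLr : r * m + 1 ≤ L := by nlinarith
    set k0 := L - r * m with hk0
    have hk01 : 1 ≤ k0 := by omega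
    have hk0L : k0 + r * m = L := by omega
    have hdiv : ∀ j, d * η 0 / β ^ k0 / β ^ j = d * (η 0 / β ^ (k0 + j)) := by
      intro j; rw [pow_add]; field_simp
    obtain ⟨j, hj, hbad⟩ := aux_bad s t hst hs (by omega) β hβ (d * η 0 / β ^ k0) (r * m) (by
      rw [hdiv, hk0L, abs_mul, abs_div, abs_of_pos (pow_pos hβ0 L)]
      have : 1 ≤ |η 0| / β ^ L := by
        rw [le_div_iff₀ (by positivity), one_mul]
        exact le_trans (pow_le_pow_right₀ hβ1.le (by omega)) hL1
      nlinarith) (by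
      rw [hdiv, hk0L, abs_mul, abs_div, abs_of_pos (pow_pos hβ0 L)]
      have h1 : |η 0| / β ^ L < β ^ (m + 1) := by
        rw [div_lt_iff₀ (by positivity), ← pow_add]
        calc |η 0| < β ^ (L + 1 + m) := hL2
          _ = _ := by congr 1; ring
      have h2 : |d| * β ^ (m + 1) + 1 ≤ (t : ℝ) ^ (r * m) := by
        have h3 : (|d| * β ^ 2 + 1) ^ m ≤ (t : ℝ) ^ (r * m) := by
          rw [pow_mul]; exact pow_le_pow_left₀ (by positivity) hr.le m
        have h4 : |d| * β ^ (m + 1) + 1 ≤ (|d| * β ^ 2 + 1) ^ m := by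
          clear h3 h1 hL1 hL2 hLm hLr hη hle hk0 hk01 hk0L hdiv
          induction m, hm using Nat.le_induction with
          | base => simp
          | succ m hm ih =>
            rw [pow_succ (|d| * β ^ 2 + 1)]
            have h5 : β ≤ |d| * β ^ 2 + 1 := by nlinarith
            calc |d| * β ^ (m + 1 + 1) + 1 ≤ (|d| * β ^ (m + 1) + 1) * (|d| * β ^ 2 + 1) := by
                  rw [pow_succ β (m + 1)]
                  have h6 : 0 < |d| * β ^ (m + 1) := by positivity
                  have h7 : 0 < |d| * β ^ 2 := by positivity
                  nlinarith
              _ ≤ _ := by gcongr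
        linarith
      have h8 : |d| * (|η 0| / β ^ L) < |d| * β ^ (m + 1) := by gcongr
      linarith)
    refine ⟨k0 + j, by omega, ?_, ?_⟩
    · apply hq
      rw [hdiv] at hbad
      rw [hcoord]
      exact hbad
    · rw [hcoord, abs_div, abs_of_pos (pow_pos hβ0 _), le_div_iff₀ (by positivity), ← pow_add]
      exact le_trans (pow_le_pow_right₀ hβ1.le (by omega)) hL1
  refine ⟨q, r + 2, hq0, hq1, by omega, ?_⟩
  intro n
  induction n with
  | zero => intro η _; simpa using ft_norm_le μ η
  | succ n ih =>
    intro η hη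
    rw [pow_succ'] at hη
    obtain ⟨k, hk1, hk2, hk3⟩ := gain ((r + 2) ^ n) η (Nat.one_le_pow _ _ (by omega)) hη
    have h1 := ih _ hk3
    rw [ft_iter hp.pos ρ₁ ρ₂ c hρ10.ne' hρ20.ne' D μ hμ k η, norm_mul, pow_succ']
    have hmem : k ∈ Finset.Icc 1 k := Finset.mem_Icc.mpr ⟨hk1, le_rfl⟩
    rw [← Finset.mul_prod_erase _ _ hmem, norm_mul, norm_prod]
    have h2 : ∏ i ∈ (Finset.Icc 1 k).erase k, ‖mask D ((affA ρ₁ ρ₂ c)^[i] η)‖ ≤ 1 :=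
      Finset.prod_le_one (fun _ _ => norm_nonneg _) (fun _ _ => mask_norm_le hp.pos _ _)
    calc _ ≤ q * 1 * q ^ n := by gcongr
      _ = _ := by ring

theorem abstract_limit {ι : Type*} (f : ι → ℝ) (hf0 : ∀ i, 0 < f i) (hf : HasSum f 1)
    (S : ℕ → Set ι) (hScover : ∀ i, ∃ M, ∀ m ≥ M, i ∈ S m) (hSne : ∀ m, ∃ i, i ∉ S m)
    (q : ℝ) (A B : ℕ) (hq0 : 0 ≤ q) (hq1 : q < 1) (hA : 2 ≤ A) (hB : 1 ≤ B)
    (g : ℕ → ι → ℝ)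
    (hg : ∀ m, ∀ F : Finset ι, (∀ i ∈ F, i ∈ S m) → ∑ i ∈ F, g m i ≤ 1)
    (hle : ∀ m i, f i ≤ g m i)
    (hstep : ∀ n m, B * A ^ n ≤ m → ∀ i ∉ S m, f i ≤ q ^ n * g (m + A ^ n) i) : False := by
  classical
  let Q : ℕ → ℝ := fun m => ∑' i, (S m).indicator f i
  have hsum : ∀ m, Summable ((S m).indicator f) := fun m => hf.summable.indicator _
  have hind0 : ∀ m i, 0 ≤ (S m).indicator f i := fun m i =>
    Set.indicator_nonneg (fun i _ => (hf0 i).le) i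
  have hQlt : ∀ m, Q m < 1 := by
    intro m
    obtain ⟨i, hi⟩ := hSne m
    rw [← hf.tsum_eq]
    refine Summable.tsum_lt_tsum (i := i) (fun j => Set.indicator_le_self' (fun j _ => (hf0 j).le) j) ?_
      (hsum m) hf.summable
    rw [Set.indicator_of_notMem hi]
    exact hf0 i
  have hQ : ∀ n m, B * A ^ n ≤ m → Q (m + A ^ n) ≤ (1 - q ^ n) * Q m + q ^ n := by
    intro n m hm
    have he0 : 0 ≤ q ^ n := pow_nonneg hq0 n
    have he1 : q ^ n ≤ 1 := pow_le_one₀ hq0 hq1.le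
    refine (hsum _).tsum_le_of_sum_le ?_
    intro F
    have h1 : ∑ i ∈ F, (S (m + A ^ n)).indicator f i ≤
        (1 - q ^ n) * ∑ i ∈ F, (S m).indicator f i
          + q ^ n * ∑ i ∈ F, (S (m + A ^ n)).indicator (g (m + A ^ n)) i := by
      rw [Finset.mul_sum, Finset.mul_sum, ← Finset.sum_add_distrib]
      refine Finset.sum_le_sum fun i _ => ?_
      by_cases h2 : i ∈ S (m + A ^ n)
      · rw [Set.indicator_of_mem h2, Set.indicator_of_mem h2]
        by_cases h3 : i ∈ S m
        · rw [Set.indicator_of_mem h3]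
          have := mul_le_mul_of_nonneg_left (hle (m + A ^ n) i) he0
          linarith
        · rw [Set.indicator_of_notMem h3]
          have := hstep n m hm i h3
          linarith
      · rw [Set.indicator_of_notMem h2, Set.indicator_of_notMem h2]
        have := mul_nonneg (sub_nonneg.mpr he1) (hind0 m i)
        linarith
    have h4 : ∑ i ∈ F, (S (m + A ^ n)).indicator (g (m + A ^ n)) i ≤ 1 := by
      rw [Finset.sum_indicator_eq_sum_filter]
      exact hg _ _ (fun i hi => (Finset.mem_filter.mp hi).2)
    have h5 : ∑ i ∈ F, (S m).indicator f i ≤ Q m := (hsum m).sum_le_tsum F (fun i _ => hind0 m i)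
    have h6 := mul_le_mul_of_nonneg_left h4 he0
    have h7 := mul_le_mul_of_nonneg_left h5 (sub_nonneg.mpr he1)
    linarith
  have hQi : ∀ n i, (1 - q ^ n) ^ i * (1 - Q (B * A ^ n)) ≤ 1 - Q (B * A ^ n + i * A ^ n) := by
    intro n i
    have he1 : q ^ n ≤ 1 := pow_le_one₀ hq0 hq1.le
    induction i with
    | zero => simp
    | succ i ih =>
      have h1 := hQ n (B * A ^ n + i * A ^ n) (by omega)
      rw [show B * A ^ n + (i + 1) * A ^ n = B * A ^ n + i * A ^ n + A ^ n by ring]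
      have h2 := mul_le_mul_of_nonneg_left ih (sub_nonneg.mpr he1)
      rw [pow_succ]
      nlinarith
  let K : ℕ := B * (A - 1)
  let w : ℕ → ℝ := fun n => 1 - Q (B * A ^ n)
  have hw0 : ∀ n, 0 < w n := fun n => sub_pos.mpr (hQlt _)
  have hw : ∀ n, (1 - K * q ^ n) * w n ≤ w (n + 1) := by
    intro n
    have he0 : 0 ≤ q ^ n := pow_nonneg hq0 n
    have he1 : q ^ n ≤ 1 := pow_le_one₀ hq0 hq1.le
    have h1 := hQi n K
    have h2 : B * A ^ n + K * A ^ n = B * A ^ (n + 1) := by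
      obtain ⟨A', rfl⟩ : ∃ A', A = A' + 1 := ⟨A - 1, by omega⟩
      simp only [K, Nat.add_sub_cancel]; ring
    rw [h2] at h1
    refine le_trans ?_ h1
    have h3 := one_add_mul_le_pow (a := -q ^ n) (by linarith) K
    refine mul_le_mul_of_nonneg_right ?_ (hw0 n).le
    rw [sub_eq_add_neg 1 (q ^ n)]
    linarith
  have hlim : Filter.Tendsto (fun n : ℕ => (K : ℝ) * q ^ n) Filter.atTop (nhds 0) := by
    simpa using (tendsto_pow_atTop_nhds_zero_of_lt_one hq0 hq1).const_mul (K : ℝ)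
  obtain ⟨n0, hn0⟩ := (hlim.eventually (ge_mem_nhds (show (0:ℝ) < (1 - q) / 2 by linarith))).exists
  have hwj : ∀ j, (1 / 2 + q ^ j / 2) * w n0 ≤ w (n0 + j) := by
    intro j
    induction j with
    | zero => simp; linarith
    | succ j ih =>
      have h1 := hw (n0 + j)
      rw [← add_assoc]
      refine le_trans ?_ h1
      have hj0 : 0 ≤ q ^ j := pow_nonneg hq0 j
      have hj1 : q ^ j ≤ 1 := pow_le_one₀ hq0 hq1.le
      have h2 : (K : ℝ) * q ^ (n0 + j) ≤ (1 - q) / 2 * q ^ j := by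
        rw [pow_add, ← mul_assoc]
        exact mul_le_mul_of_nonneg_right hn0 hj0
      have h3 : 0 ≤ 1 - (1 - q) / 2 * q ^ j := by nlinarith
      have h4 : (1 - (1 - q) / 2 * q ^ j) * ((1 / 2 + q ^ j / 2) * w n0) ≤
          (1 - K * q ^ (n0 + j)) * w (n0 + j) := by
        apply mul_le_mul _ ih _ _
        · linarith
        · have := hw0 n0; positivity
        · linarith
      refine le_trans ?_ h4
      rw [← mul_assoc]
      refine mul_le_mul_of_nonneg_right ?_ (hw0 n0).le
      rw [pow_succ]
      nlinarith [mul_nonneg (mul_nonneg (sub_nonneg.mpr hq1.le) hj0) (sub_nonneg.mpr hj1)]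
  have hhalf : ∀ j, w n0 / 2 ≤ w (n0 + j) := by
    intro j
    refine le_trans ?_ (hwj j)
    have := mul_nonneg (pow_nonneg hq0 j) (hw0 n0).le
    linarith
  have hex : ∃ F : Finset ι, 1 - w n0 / 2 < ∑ i ∈ F, f i :=
    ((show Filter.Tendsto (fun F : Finset ι => ∑ i ∈ F, f i) Filter.atTop (nhds 1) from hf).eventually
      (lt_mem_nhds (show 1 - w n0 / 2 < 1 by have := hw0 n0; linarith))).exists
  obtain ⟨F, hF⟩ := hex
  choose M hM using hScover
  let m1 := F.sup M
  have h1 : m1 ≤ B * A ^ (n0 + m1) := by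
    have : n0 + m1 < A ^ (n0 + m1) := Nat.lt_pow_self (by omega)
    nlinarith
  have h2 : ∑ i ∈ F, f i ≤ Q (B * A ^ (n0 + m1)) := by
    refine le_trans (le_of_eq ?_) ((hsum _).sum_le_tsum F (fun i _ => hind0 _ i))
    refine Finset.sum_congr rfl fun i hi => ?_
    rw [Set.indicator_of_mem]
    exact hM i _ (le_trans (Finset.le_sup hi) h1)
  have h3 := hhalf m1
  simp only [w] at h3 hF
  linarith

theorem zero_level {p : ℕ} (hp : p.Prime) (ρ₁ ρ₂ c : ℝ) (hρ10 : 0 < ρ₁)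
    (D : Fin p → (Fin 2 → ℤ)) (a : Fin 2 → ℤ) (hZ : ZeroSetCond p D a) (k : ℕ) (η : Fin 2 → ℝ)
    (h : mask (digitR D) ((affA ρ₁ ρ₂ c)^[k] η) = 0) :
    ∃ z : ℤ, ¬ (p : ℤ) ∣ z ∧ p * η 0 = z * ρ₁⁻¹ ^ k := by
  obtain ⟨j, hj1, hj2, n, hn⟩ := (hZ.2 _).mp h
  have hp1 := hp.two_le
  refine ⟨j * a 0 + p * n 0, ?_, ?_⟩
  · intro hd
    have h1 : (p : ℤ) ∣ (j : ℤ) * a 0 := (Int.dvd_add_left (dvd_mul_right _ _)).mp hd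
    rcases (Nat.prime_iff_prime_int.mp hp).dvd_or_dvd h1 with h2 | h2
    · have := Int.le_of_dvd (by omega) h2
      omega
    · have h3 := hZ.1 0
      have := Int.le_of_dvd (by omega) h2
      omega
  · have h1 := hn 0
    rw [affA_iter_zero] at h1
    have hp0 : (p : ℝ) ≠ 0 := by exact_mod_cast hp.ne_zero
    have hk : ρ₁ ^ k ≠ 0 := pow_ne_zero _ hρ10.ne'
    have h2 : η 0 = ((j : ℝ) * (a 0 : ℝ) / p + (n 0 : ℝ)) / ρ₁ ^ k := by
      rw [← h1]; field_simp
    rw [h2, inv_pow]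
    push_cast
    field_simp

theorem level_occurs {p : ℕ} (hp : p.Prime) (ρ₁ ρ₂ c : ℝ) (hρ10 : 0 < ρ₁) (hρ11 : ρ₁ < 1)
    (hρ20 : 0 < ρ₂) (hρ21 : ρ₂ < 1)
    (D : Fin p → (Fin 2 → ℝ)) (hD0 : D ⟨0, hp.pos⟩ = 0)
    (hD11 : D ⟨1, hp.one_lt⟩ 1 = 0) (hD1 : D ⟨1, hp.one_lt⟩ 0 ≠ 0)
    (μ : Measure (Fin 2 → ℝ)) (hμ : IsSelfAffine μ (Mupper ρ₁ ρ₂ c) D)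
    (Λ : Set (Fin 2 → ℝ))
    (hΛ : ∀ l ∈ Λ, ∀ l' ∈ Λ, l ≠ l' → ftMeasure μ (l - l') = 0)
    (hsum : ∀ ξ, HasSum (fun l : Λ => ‖ftMeasure μ (ξ - l)‖ ^ 2) 1)
    (k0 : ℕ) (hk0 : 1 ≤ k0) :
    ∃ l ∈ Λ, ∃ l' ∈ Λ, mask D ((affA ρ₁ ρ₂ c)^[k0] (l - l')) = 0 := by
  classical
  have := hμ.1
  by_contra hcon
  push Not at hcon
  have hne : Nonempty Λ := by
    by_contra h
    rw [not_nonempty_iff] at h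
    have := (hsum 0).unique hasSum_empty
    norm_num at this
  obtain ⟨l0⟩ := hne
  let d := D ⟨1, hp.one_lt⟩ 0
  let v : ℝ → (Fin 2 → ℝ) := fun e => ![e, 0]
  have hv : Continuous v := by
    refine continuous_pi fun i => ?_
    fin_cases i <;> simp [v] <;> fun_prop
  have hv0 : v 0 = 0 := by ext i; fin_cases i <;> simp [v]
  have hev1 : ∀ᶠ e in nhds (0 : ℝ), ftMeasure μ (v e) ≠ 0 := by
    apply ((ft_continuous μ).comp hv).continuousAt.eventually_ne
    simp [hv0, ft_zero]
  have hev2 : ∀ᶠ e in nhds (0 : ℝ), |d * (ρ₁ ^ k0 * e)| < 1 / 2 := by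
    have : ContinuousAt (fun e : ℝ => |d * (ρ₁ ^ k0 * e)|) 0 := by fun_prop
    apply this.eventually_lt continuousAt_const
    simp
  obtain ⟨e, ⟨he1, he2⟩, he3⟩ :=
    (((hev1.and hev2).filter_mono nhdsWithin_le_nhds).and
      (self_mem_nhdsWithin : Set.Ioi (0:ℝ) ∈ nhdsWithin 0 (Set.Ioi 0))).exists
  have he3 : 0 < e := he3
  let η := v e
  have hη0 : η 0 = e := by simp [η, v]
  have hδ0 : 0 < |d * (ρ₁ ^ k0 * e)| := by
    apply abs_pos.mpr
    have : ρ₁ ^ k0 ≠ 0 := pow_ne_zero _ hρ10.ne'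
    have : d ≠ 0 := hD1
    have := he3.ne'
    positivity
  obtain ⟨g, hg0, hg1, hg⟩ := mask_bound hp D hD0 hD11 _ hδ0 he2.le
  have hgη : ‖mask D ((affA ρ₁ ρ₂ c)^[k0] η)‖ ≤ g := by
    apply hg
    rw [affA_iter_zero, hη0]
    have : round (d * (ρ₁ ^ k0 * e)) = 0 := by
      rw [round_eq_zero_iff]
      rw [abs_lt] at he2
      exact ⟨by linarith, by linarith⟩
    simp only [d] at this ⊢
    rw [this]; simp
  let ξ := (l0 : Fin 2 → ℝ) + η
  have hξ : ξ - l0 = η := by simp [ξ]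
  have hlev : ∀ l l' : Λ, ∃ k : ℕ, l ≠ l' → 1 ≤ k ∧ k ≠ k0 ∧
      mask D ((affA ρ₁ ρ₂ c)^[k] ((l : Fin 2 → ℝ) - l')) = 0 := by
    intro l l'
    by_cases h : l = l'
    · exact ⟨0, fun h' => absurd h h'⟩
    · obtain ⟨k, hk1, hk2⟩ := ft_ne_zero hp.pos ρ₁ ρ₂ c hρ10 hρ11 hρ20 hρ21 D μ hμ _
        (hΛ l l.2 l' l'.2 (fun h' => h (Subtype.ext h')))
      refine ⟨k, fun _ => ⟨hk1, ?_, hk2⟩⟩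
      rintro rfl
      exact hcon l l.2 l' l'.2 hk2
  choose lev hlev using hlev
  have hpos : 0 < ‖ftMeasure μ η‖ ^ 2 * (1 - g ^ 2) := by
    have h1 : 0 < ‖ftMeasure μ η‖ := norm_pos_iff.mpr he1
    have h2 : 0 < 1 - g ^ 2 := by nlinarith
    positivity
  have hfin : ∀ F : Finset Λ, l0 ∈ F →
      ∑ l ∈ F, ‖ftMeasure μ (ξ - l)‖ ^ 2 ≤ 1 - ‖ftMeasure μ η‖ ^ 2 * (1 - g ^ 2) := by
    intro F hF
    let m := max k0 ((F ×ˢ F).sup fun q => lev q.1 q.2)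
    let T := (Finset.Icc 1 m).erase k0
    let P : (Fin 2 → ℝ) → ℂ := fun x => ∏ k ∈ T, mask D ((affA ρ₁ ρ₂ c)^[k] x)
    have hkm : k0 ∈ Finset.Icc 1 m := Finset.mem_Icc.mpr ⟨hk0, le_max_left _ _⟩
    have hb : ∑ l ∈ F, ‖P (ξ - l)‖ ^ 2 ≤ 1 := by
      have := bessel hp.pos ρ₁ ρ₂ c D T (F.map (Function.Embedding.subtype _)) ?_ ξ
      · rw [Finset.sum_map] at this
        exact this
      · intro l hl l' hl' hne
        rw [Finset.mem_map] at hl hl'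
        obtain ⟨x, hx, rfl⟩ := hl
        obtain ⟨y, hy, rfl⟩ := hl'
        have hxy : x ≠ y := fun h => hne (by rw [h])
        obtain ⟨h1, h2, h3⟩ := hlev x y hxy
        refine ⟨lev x y, Finset.mem_erase.mpr ⟨h2, Finset.mem_Icc.mpr ⟨h1, ?_⟩⟩, h3⟩
        refine le_trans ?_ (le_max_right _ _)
        exact Finset.le_sup (f := fun q : Λ × Λ => lev q.1 q.2) (b := (x, y))
          (Finset.mem_product.mpr ⟨hx, hy⟩)
    have hft : ∀ x, ‖ftMeasure μ x‖ ≤ ‖mask D ((affA ρ₁ ρ₂ c)^[k0] x)‖ * ‖P x‖ := by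
      intro x
      rw [ft_iter hp.pos ρ₁ ρ₂ c hρ10.ne' hρ20.ne' D μ hμ m x, ← Finset.mul_prod_erase _ _ hkm,
        norm_mul, norm_mul]
      exact mul_le_of_le_one_right (by positivity) (ft_norm_le μ _)
    have hft1 : ∀ x, ‖ftMeasure μ x‖ ^ 2 ≤ ‖P x‖ ^ 2 := by
      intro x
      refine pow_le_pow_left₀ (norm_nonneg _) ((hft x).trans ?_) 2
      exact mul_le_of_le_one_left (norm_nonneg _) (mask_norm_le hp.pos D _)
    have hft2 : ‖ftMeasure μ η‖ ^ 2 ≤ g ^ 2 * ‖P η‖ ^ 2 := by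
      rw [← mul_pow]
      refine pow_le_pow_left₀ (norm_nonneg _) ((hft η).trans ?_) 2
      exact mul_le_mul_of_nonneg_right hgη (norm_nonneg _)
    rw [← Finset.add_sum_erase _ _ hF] at hb ⊢
    rw [hξ] at hb ⊢
    have h5 : ∑ l ∈ F.erase l0, ‖ftMeasure μ (ξ - l)‖ ^ 2 ≤ ∑ l ∈ F.erase l0, ‖P (ξ - l)‖ ^ 2 :=
      Finset.sum_le_sum fun l _ => hft1 _
    have h6 := hft1 η
    have h7 : (0:ℝ) ≤ 1 - g ^ 2 := by nlinarith
    have h8 := mul_le_mul_of_nonneg_right h6 h7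
    nlinarith
  have hle : (1 : ℝ) ≤ 1 - ‖ftMeasure μ η‖ ^ 2 * (1 - g ^ 2) := by
    refine le_of_tendsto (hsum ξ) ?_
    filter_upwards [Filter.eventually_ge_atTop {l0}] with F hF
    exact hfin F (hF (Finset.mem_singleton_self _))
  linarith

theorem denom_one {p : ℕ} (hp : p.Prime) (ρ₁ ρ₂ c : ℝ) (hρ10 : 0 < ρ₁) (hρ11 : ρ₁ < 1)
    (hρ20 : 0 < ρ₂) (hρ21 : ρ₂ < 1)
    (D : Fin p → (Fin 2 → ℝ)) (hD0 : D ⟨0, hp.pos⟩ = 0)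
    (hD11 : D ⟨1, hp.one_lt⟩ 1 = 0) (hD1 : 1 ≤ |D ⟨1, hp.one_lt⟩ 0|)
    (μ : Measure (Fin 2 → ℝ)) (hμ : IsSelfAffine μ (Mupper ρ₁ ρ₂ c) D)
    (hzero : ∀ (k : ℕ) (η : Fin 2 → ℝ), mask D ((affA ρ₁ ρ₂ c)^[k] η) = 0 →
      ∃ z : ℤ, ¬ (p : ℤ) ∣ z ∧ p * η 0 = z * ρ₁⁻¹ ^ k)
    (Λ : Set (Fin 2 → ℝ))
    (hΛ : ∀ l ∈ Λ, ∀ l' ∈ Λ, l ≠ l' → ftMeasure μ (l - l') = 0)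
    (hsum : ∀ ξ, HasSum (fun l : Λ => ‖ftMeasure μ (ξ - l)‖ ^ 2) 1)
    (s t : ℕ) (hst : Nat.Coprime s t) (ht : 2 ≤ t) (hβ : ρ₁⁻¹ = s / t)
    (hbd : ∀ l ∈ Λ, ∀ l' ∈ Λ, ∀ k : ℕ, 1 ≤ k →
      mask D ((affA ρ₁ ρ₂ c)^[k] (l - l')) = 0 → (s : ℝ) ^ (k - 1) ≤ p * |l 0 - l' 0|) : False := by
  classical
  have := hμ.1
  have hd1 : D ⟨1, hp.one_lt⟩ 0 ≠ 0 := by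
    intro h; rw [h] at hD1; norm_num at hD1
  have hocc := level_occurs hp ρ₁ ρ₂ c hρ10 hρ11 hρ20 hρ21 D hD0 hD11 hd1 μ hμ Λ hΛ hsum
  obtain ⟨l0, hl0, -⟩ := hocc 1 le_rfl
  obtain ⟨q, A, hq0, hq1, hA, hdec⟩ :=
    decay hp ρ₁ ρ₂ c hρ10 hρ11 hρ20 D μ hμ hD0 hD11 hD1 s t hst ht hβ
  have hp0 : (0 : ℝ) < p := by exact_mod_cast hp.pos
  have hp2 : (2 : ℝ) ≤ p := by exact_mod_cast hp.two_le
  have ht2 : (2 : ℝ) ≤ t := by exact_mod_cast ht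
  have ht0 : (0 : ℝ) < t := by linarith
  set β := ρ₁⁻¹ with hβdef
  have hβ1 : 1 < β := (one_lt_inv₀ hρ10).mpr hρ11
  have hβ0 : 0 < β := by linarith
  have hsβ : (s : ℝ) = t * β := by rw [hβ]; field_simp
  have hs2 : (2 : ℝ) < s := by rw [hsβ]; nlinarith
  let ξ : Fin 2 → ℝ := l0 + ![Real.sqrt 2, 0]
  have hξ0 : ξ 0 = l0 0 + Real.sqrt 2 := rfl
  -- rationality
  have hrat : ∀ (x : ℝ) (z : ℤ) (k : ℕ), p * x = z * β ^ k → ∃ r : ℚ, (r : ℝ) = x := by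
    intro x z k h
    refine ⟨z * ((s : ℚ) / t) ^ k / p, ?_⟩
    push_cast
    rw [← hβ, ← h]
    field_simp
  have hft : ∀ l : Λ, ftMeasure μ (ξ - l) ≠ 0 := by
    intro l h
    obtain ⟨k, -, hk⟩ := ft_ne_zero hp.pos ρ₁ ρ₂ c hρ10 hρ11 hρ20 hρ21 D μ hμ _ h
    obtain ⟨z, -, hz⟩ := hzero k _ hk
    obtain ⟨r, hr⟩ := hrat _ z k hz
    have h2 : ∃ r' : ℚ, (r' : ℝ) = l0 0 - (l : Fin 2 → ℝ) 0 := by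
      by_cases hl : l0 = l
      · exact ⟨0, by rw [hl]; simp⟩
      · obtain ⟨k', -, hk'⟩ := ft_ne_zero hp.pos ρ₁ ρ₂ c hρ10 hρ11 hρ20 hρ21 D μ hμ _
          (hΛ l0 hl0 l l.2 hl)
        obtain ⟨z', -, hz'⟩ := hzero k' _ hk'
        exact hrat _ z' k' hz'
    obtain ⟨r', hr'⟩ := h2
    refine irrational_sqrt_two ⟨r - r', ?_⟩
    push_cast
    rw [hr, hr', Pi.sub_apply, hξ0]
    ring
  let C : ℝ := 2 * p * (|ξ 0| + 1) * β ^ 2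
  have hC1 : 1 ≤ 2 * p * (|ξ 0| + 1) := by
    have := abs_nonneg (ξ 0)
    nlinarith [mul_nonneg hp0.le this]
  obtain ⟨B0, hB0⟩ := pow_unbounded_of_one_lt C (show (1:ℝ) < t by linarith)
  let B := B0 + 1
  have hB : C ≤ (t : ℝ) ^ B := by
    refine hB0.le.trans ?_
    exact pow_le_pow_right₀ (by linarith) (Nat.le_succ _)
  let P : ℕ → (Fin 2 → ℝ) → ℂ := fun m x => ∏ k ∈ Finset.Icc 1 m, mask D ((affA ρ₁ ρ₂ c)^[k] x)
  have hftP : ∀ m x, ‖ftMeasure μ x‖ = ‖P m x‖ * ‖ftMeasure μ ((affA ρ₁ ρ₂ c)^[m] x)‖ := by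
    intro m x
    rw [ft_iter hp.pos ρ₁ ρ₂ c hρ10.ne' hρ20.ne' D μ hμ m x, norm_mul]
  refine abstract_limit (fun l : Λ => ‖ftMeasure μ (ξ - l)‖ ^ 2)
    (fun l => by have := norm_pos_iff.mpr (hft l); positivity) (hsum ξ)
    (fun m => {l : Λ | |(l : Fin 2 → ℝ) 0| < (s : ℝ) ^ m / (2 * p)}) ?_ ?_ q A B hq0 hq1 hA
    (Nat.succ_le_succ (Nat.zero_le _)) (fun m l => ‖P m (ξ - l)‖ ^ 2) ?_ ?_ ?_
  · intro l
    obtain ⟨M, hM⟩ := pow_unbounded_of_one_lt (|(l : Fin 2 → ℝ) 0| * (2 * p))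
      (show (1:ℝ) < s by linarith)
    refine ⟨M, fun m hm => ?_⟩
    rw [Set.mem_ofPred_eq]
    rw [lt_div_iff₀ (by positivity)]
    exact hM.trans_le (pow_le_pow_right₀ (by linarith) hm)
  · intro m
    by_contra hcon
    push Not at hcon
    obtain ⟨l, hl, l', hl', h⟩ := hocc (m + 1) (by omega)
    have h1 := hbd l hl l' hl' (m + 1) (by omega) h
    have h2 : |l 0| < (s : ℝ) ^ m / (2 * p) := hcon ⟨l, hl⟩
    have h3 : |l' 0| < (s : ℝ) ^ m / (2 * p) := hcon ⟨l', hl'⟩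
    rw [lt_div_iff₀ (by positivity)] at h2 h3
    rw [Nat.add_sub_cancel] at h1
    have h4 := mul_le_mul_of_nonneg_left (abs_sub (l 0) (l' 0)) hp0.le
    linarith
  · intro m F hF
    have := bessel hp.pos ρ₁ ρ₂ c D (Finset.Icc 1 m) (F.map (Function.Embedding.subtype _)) ?_ ξ
    · rw [Finset.sum_map] at this
      exact this
    · intro l hl l' hl' hne
      rw [Finset.mem_map] at hl hl'
      obtain ⟨x, hx, rfl⟩ := hl
      obtain ⟨y, hy, rfl⟩ := hl'
      obtain ⟨k, hk1, hk⟩ := ft_ne_zero hp.pos ρ₁ ρ₂ c hρ10 hρ11 hρ20 hρ21 D μ hμ _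
          (hΛ x x.2 y y.2 hne)
      refine ⟨k, Finset.mem_Icc.mpr ⟨hk1, ?_⟩, hk⟩
      have h1 := hbd x x.2 y y.2 k hk1 hk
      have h2 : |(x : Fin 2 → ℝ) 0| < (s : ℝ) ^ m / (2 * p) := hF x hx
      have h3 : |(y : Fin 2 → ℝ) 0| < (s : ℝ) ^ m / (2 * p) := hF y hy
      rw [lt_div_iff₀ (by positivity)] at h2 h3
      have h4 := mul_le_mul_of_nonneg_left (abs_sub ((x : Fin 2 → ℝ) 0) ((y : Fin 2 → ℝ) 0)) hp0.le
      have h5 : (s : ℝ) ^ (k - 1) < (s : ℝ) ^ m := by linarith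
      have := (pow_lt_pow_iff_right₀ (show (1:ℝ) < s by linarith)).mp h5
      omega
  · intro m l
    refine pow_le_pow_left₀ (norm_nonneg _) ?_ 2
    rw [hftP m]
    exact mul_le_of_le_one_right (norm_nonneg _) (ft_norm_le μ _)
  · intro n m hm l hl
    have hl : (s : ℝ) ^ m / (2 * p) ≤ |(l : Fin 2 → ℝ) 0| := not_lt.mp hl
    have hqn0 : 0 ≤ q ^ n := pow_nonneg hq0 n
    have hqn1 : q ^ n ≤ 1 := pow_le_one₀ hq0 hq1.le
    have hAn : A ^ n ≠ 0 := pow_ne_zero _ (by omega)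
    have h1 : 2 * p * (|ξ 0| + 1) * β ^ (2 * A ^ n) ≤ (t : ℝ) ^ m := by
      calc 2 * p * (|ξ 0| + 1) * β ^ (2 * A ^ n)
          ≤ (2 * p * (|ξ 0| + 1)) ^ (A ^ n) * (β ^ 2) ^ (A ^ n) := by
            rw [← pow_mul]
            exact mul_le_mul_of_nonneg_right (le_self_pow₀ hC1 hAn) (by positivity)
        _ = C ^ (A ^ n) := by rw [← mul_pow]
        _ ≤ ((t : ℝ) ^ B) ^ (A ^ n) := pow_le_pow_left₀ (by positivity) hB _
        _ = (t : ℝ) ^ (B * A ^ n) := by rw [← pow_mul]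
        _ ≤ (t : ℝ) ^ m := pow_le_pow_right₀ (by linarith) hm
    have h2 : (|ξ 0| + 1) * β ^ (2 * A ^ n + m) ≤ (s : ℝ) ^ m / (2 * p) := by
      rw [le_div_iff₀ (by positivity), hsβ, mul_pow, pow_add]
      have := mul_le_mul_of_nonneg_right h1 (pow_nonneg hβ0.le m)
      linarith
    have h3 : 1 ≤ β ^ (2 * A ^ n + m) := one_le_pow₀ hβ1.le
    have h4 : β ^ (2 * A ^ n + m) ≤ |ξ 0 - (l : Fin 2 → ℝ) 0| := by
      have h5 := abs_sub_abs_le_abs_sub ((l : Fin 2 → ℝ) 0) (ξ 0)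
      rw [abs_sub_comm] at h5
      have := mul_le_mul_of_nonneg_left h3 (abs_nonneg (ξ 0))
      linarith
    have h5 : β ^ (A ^ n) ≤ |((affA ρ₁ ρ₂ c)^[m + A ^ n] (ξ - l)) 0| := by
      rw [affA_iter_zero, abs_mul, abs_of_pos (pow_pos hρ10 _), Pi.sub_apply]
      have e : ρ₁ ^ (m + A ^ n) * β ^ (2 * A ^ n + m) = β ^ (A ^ n) := by
        rw [show 2 * A ^ n + m = (m + A ^ n) + A ^ n by ring, pow_add β, ← mul_assoc, ← mul_pow,
          hβdef, mul_inv_cancel₀ hρ10.ne', one_pow, one_mul]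
      rw [← e]
      exact mul_le_mul_of_nonneg_left h4 (by positivity)
    have h6 := hdec n _ h5
    show ‖ftMeasure μ (ξ - l)‖ ^ 2 ≤ q ^ n * ‖P (m + A ^ n) (ξ - l)‖ ^ 2
    rw [hftP (m + A ^ n), mul_pow, mul_comm]
    refine mul_le_mul_of_nonneg_right ?_ (by positivity)
    have h7 := norm_nonneg (ftMeasure μ ((affA ρ₁ ρ₂ c)^[m + A ^ n] (ξ - l)))
    nlinarith


/-- Lemma 3.7: if `μ_{M,D}` is a spectral measure then `ρ₁⁻¹` is an integer
divisible by `p`. -/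
theorem stmt11 (p : ℕ) (hp : p.Prime) (ρ₁ ρ₂ c : ℝ)
    (hρ10 : 0 < ρ₁) (hρ11 : ρ₁ < 1) (hρ20 : 0 < ρ₂) (hρ21 : ρ₂ < 1)
    (D : Fin p → (Fin 2 → ℤ)) (hD : Function.Injective D)
    (a : Fin 2 → ℤ) (hZ : ZeroSetCond p D a)
    (hD0 : D ⟨0, hp.pos⟩ = 0)
    (hD11 : D ⟨1, hp.one_lt⟩ 1 = 0) (hD10 : D ⟨1, hp.one_lt⟩ 0 ≠ 0)
    (μ : Measure (Fin 2 → ℝ)) (hμ : IsSelfAffine μ (Mupper ρ₁ ρ₂ c) (digitR D))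
    (hspec : IsSpectral μ) :
    ∃ n : ℤ, (p : ℤ) ∣ n ∧ ρ₁⁻¹ = (n : ℝ) := by
  have := hμ.1
  obtain ⟨Λ, -, b, hb⟩ := hspec
  obtain ⟨hΛ, hsum⟩ := parseval μ Λ b hb
  have hp0 : (0 : ℝ) < p := by exact_mod_cast hp.pos
  have hD0' : digitR D ⟨0, hp.pos⟩ = 0 := by
    ext i; simp [digitR, hD0]
  have hD11' : digitR D ⟨1, hp.one_lt⟩ 1 = 0 := by simp [digitR, hD11]
  have hD10' : digitR D ⟨1, hp.one_lt⟩ 0 ≠ 0 := by simpa [digitR] using hD10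
  have hD1 : 1 ≤ |digitR D ⟨1, hp.one_lt⟩ 0| := by
    have : (1 : ℤ) ≤ |D ⟨1, hp.one_lt⟩ 0| := Int.one_le_abs hD10
    simp only [digitR]
    exact_mod_cast this
  have hzero := zero_level hp ρ₁ ρ₂ c hρ10 D a hZ
  have hocc := level_occurs hp ρ₁ ρ₂ c hρ10 hρ11 hρ20 hρ21 (digitR D) hD0' hD11' hD10' μ hμ Λ hΛ hsum
  have hβ1 : 1 < ρ₁⁻¹ := (one_lt_inv₀ hρ10).mpr hρ11
  have hX1 : ∀ x ∈ ((fun l : Fin 2 → ℝ => (p : ℝ) * l 0) '' Λ), ∀ y ∈ ((fun l : Fin 2 → ℝ => (p : ℝ) * l 0) '' Λ), x ≠ y →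
      ∃ k : ℕ, 1 ≤ k ∧ ∃ z : ℤ, ¬ (p:ℤ) ∣ z ∧ x - y = z * ρ₁⁻¹ ^ k := by
    rintro _ ⟨l, hl, rfl⟩ _ ⟨l', hl', rfl⟩ hne
    have hll : l ≠ l' := fun h => hne (by rw [h])
    obtain ⟨k, hk1, hk⟩ := ft_ne_zero hp.pos ρ₁ ρ₂ c hρ10 hρ11 hρ20 hρ21 (digitR D) μ hμ _
      (hΛ l hl l' hl' hll)
    obtain ⟨z, hz1, hz2⟩ := hzero k _ hk
    rw [Pi.sub_apply] at hz2
    exact ⟨k, hk1, z, hz1, by rw [← hz2]; ring⟩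
  have hX2 : ∀ k : ℕ, 1 ≤ k → ∃ x ∈ ((fun l : Fin 2 → ℝ => (p : ℝ) * l 0) '' Λ), ∃ y ∈ ((fun l : Fin 2 → ℝ => (p : ℝ) * l 0) '' Λ),
      ∃ z : ℤ, ¬ (p:ℤ) ∣ z ∧ x - y = z * ρ₁⁻¹ ^ k := by
    intro k hk
    obtain ⟨l, hl, l', hl', h⟩ := hocc k hk
    obtain ⟨z, hz1, hz2⟩ := hzero k _ h
    rw [Pi.sub_apply] at hz2
    exact ⟨_, ⟨l, hl, rfl⟩, _, ⟨l', hl', rfl⟩, z, hz1, by rw [← hz2]; ring⟩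
  obtain ⟨s, t, hst, ht, hβ, hps, hbd⟩ := aux_arith p hp ρ₁⁻¹ hβ1
    ((fun l : Fin 2 → ℝ => (p : ℝ) * l 0) '' Λ) hX1 hX2
  · by_cases ht1 : t = 1
    · refine ⟨s, by exact_mod_cast hps, ?_⟩
      rw [hβ, ht1]; simp
    · exfalso
      refine denom_one hp ρ₁ ρ₂ c hρ10 hρ11 hρ20 hρ21 (digitR D) hD0' hD11' hD1 μ hμ hzero Λ hΛ hsum
        s t hst (by omega) hβ ?_
      intro l hl l' hl' k hk h
      obtain ⟨z, hz1, hz2⟩ := hzero k _ h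
      rw [Pi.sub_apply] at hz2
      have h1 := hbd _ ⟨l, hl, rfl⟩ _ ⟨l', hl', rfl⟩ k z hk hz1 (by rw [← hz2]; ring)
      refine h1.trans (le_of_eq ?_)
      simp only []
      rw [← mul_sub, abs_mul, abs_of_pos hp0]

end
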